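/- There exists a constant c > 0 such that for every prime p > 2, every generator h of F_p^*, and every integer N with 1 ≤ N ≤ p^(1/2), the set {h^x·(h^y + h^z + h^t + h^v) : x,y,z,t,v ∈ ℤ, 1 ≤ x,y,z,t,v ≤ N} has cardinality at least c·N^2. -/

import Mathlib

open Finset


namespace GKL

open MvPolynomial

lemma card_set_deg (D : ℕ) :
    Nat.card {n : Fin 3 →₀ ℕ | (n.sum fun _ e => e) ≤ D} = (D + 3).choose 3 := by
  classical
  have h1 : {n : Fin 3 →₀ ℕ | (n.sum fun _ e => e) ≤ D} =
      (((Finset.range (D + 1)).biUnion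
        (fun i => (Finset.univ : Finset (Fin 3)).finsuppAntidiag i) : Finset (Fin 3 →₀ ℕ)) :
          Set (Fin 3 →₀ ℕ)) := by
    ext n
    simp [Finset.mem_finsuppAntidiag, Finsupp.sum_fintype]
  rw [h1, Nat.card_coe_set_eq, Set.ncard_coe_finset, Finset.card_biUnion]
  · simp only [Finset.card_finsuppAntidiag_nat_eq_choose, Finset.card_univ, Fintype.card_fin]
    induction D with
    | zero => simp
    | succ D ih =>
      rw [Finset.sum_range_succ, ih]
      · have : (3 + (D + 1) - 1).choose (D + 1) = (D + 3).choose 2 := by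
          rw [show 3 + (D+1) - 1 = (D+1) + 2 by omega, Nat.choose_symm_add]
        rw [this]
        rw [show D + 1 + 3 = (D + 3) + 1 by ring, Nat.choose_succ_succ' (D+3) 2]
        ring
      · ext n
        simp [Finset.mem_finsuppAntidiag, Finsupp.sum_fintype]
  · intro i _ j _ hij
    rw [Function.onFun, Finset.disjoint_left]
    intro n hn hn'
    rw [Finset.mem_finsuppAntidiag] at hn hn'
    exact hij (hn.1.symm.trans hn'.1)

variable {K : Type*} [Field K]

lemma finrank_V (D : ℕ) :
    Module.finrank K (restrictTotalDegree (Fin 3) K D) = (D + 3).choose 3 := by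
  rw [← card_set_deg D]
  exact Module.finrank_eq_nat_card_basis
    (basisRestrictSupport K {n : Fin 3 →₀ ℕ | (n.sum fun _ e => e) ≤ D})

/-- a line `y = s t + β`, `z = s y + e`. -/
@[ext]
structure Ln (K : Type*) where
  s : K
  β : K
  e : K

noncomputable def res (v : Ln K) : MvPolynomial (Fin 3) K →ₐ[K] Polynomial K :=
  aeval ![Polynomial.X, Polynomial.C v.s * Polynomial.X + Polynomial.C v.β,
    Polynomial.C (v.s ^ 2) * Polynomial.X + Polynomial.C (v.s * v.β + v.e)]

lemma res_C (v : Ln K) (a : K) : res v (C a) = Polynomial.C a := by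
  simp [res]

lemma res_X0 (v : Ln K) : res v (X 0) = Polynomial.X := by
  simp [res]

lemma res_X1 (v : Ln K) : res v (X 1) =
    Polynomial.C v.s * Polynomial.X + Polynomial.C v.β := by
  simp [res]

lemma res_X2 (v : Ln K) : res v (X 2) =
    Polynomial.C (v.s ^ 2) * Polynomial.X + Polynomial.C (v.s * v.β + v.e) := by
  simp [res]

lemma res_natDegree_le (v : Ln K) (F : MvPolynomial (Fin 3) K) {m : ℕ}
    (hF : F.totalDegree ≤ m) : (res v F).natDegree ≤ m := by
  have := MvPolynomial.aeval_natDegree_le F hF ![Polynomial.X, Polynomial.C v.s * Polynomial.X + Polynomial.C v.β,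
    Polynomial.C (v.s ^ 2) * Polynomial.X + Polynomial.C (v.s * v.β + v.e)] (n := 1) ?_
  · simpa [res] using this
  · intro i
    fin_cases i
    · simp
    · show (Polynomial.C v.s * Polynomial.X + Polynomial.C v.β).natDegree ≤ 1
      exact Polynomial.natDegree_linear_le
    · show (Polynomial.C (v.s ^ 2) * Polynomial.X + Polynomial.C (v.s * v.β + v.e)).natDegree ≤ 1
      exact Polynomial.natDegree_linear_le

/-- the point of `v` at parameter `t` -/
def pt (v : Ln K) (t : K) : Fin 3 → K :=
  ![t, v.s * t + v.β, v.s ^ 2 * t + (v.s * v.β + v.e)]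

lemma eval_res (v : Ln K) (F : MvPolynomial (Fin 3) K) (t : K) :
    (res v F).eval t = MvPolynomial.eval (pt v t) F := by
  have : (Polynomial.aeval t).comp (res v) = (MvPolynomial.aeval (pt v t) : MvPolynomial (Fin 3) K →ₐ[K] K) := by
    apply MvPolynomial.algHom_ext
    intro i
    fin_cases i <;> simp [res, pt]
  have h2 := DFunLike.congr_fun this F
  simpa [Polynomial.aeval_def, Polynomial.eval₂_eq_eval_map, MvPolynomial.aeval_eq_eval] using h2

lemma derivative_res (v : Ln K) (F : MvPolynomial (Fin 3) K) :
    Polynomial.derivative (res v F) =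
      res v (pderiv 0 F + C v.s * pderiv 1 F + C (v.s^2) * pderiv 2 F) := by
  induction F using MvPolynomial.induction_on with
  | C a => simp [res_C]
  | add p q hp hq =>
    simp only [map_add, hp, hq, map_mul]; ring
  | mul_X p i hp =>
    rw [map_mul, Polynomial.derivative_mul, hp]
    simp only [map_add, map_mul, pderiv_mul]
    fin_cases i
    · simp [res_C, res_X0, pderiv_X]; ring
    · simp [res_C, res_X1, pderiv_X]; ring
    · simp only [Fin.reduceFinMk, res_C, res_X2, pderiv_X]
      simp only [Polynomial.derivative_add, Polynomial.derivative_mul, Polynomial.derivative_C,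
        Polynomial.derivative_X]
      simp
      ring

lemma pderiv_comm (i j : Fin 3) (F : MvPolynomial (Fin 3) K) :
    pderiv i (pderiv j F) = pderiv j (pderiv i F) := by
  have : ⁅(pderiv i : Derivation K (MvPolynomial (Fin 3) K) (MvPolynomial (Fin 3) K)),
      (pderiv j : Derivation K (MvPolynomial (Fin 3) K) (MvPolynomial (Fin 3) K))⁆ = 0 := by
    apply MvPolynomial.derivation_ext
    intro k
    rw [Derivation.commutator_apply]
    simp only [pderiv_X]
    simp only [Pi.single_apply]
    split_ifs <;> simp
  have h2 := DFunLike.congr_fun this F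
  rw [Derivation.commutator_apply] at h2
  simpa [sub_eq_zero] using h2

lemma totalDegree_pderiv (i : Fin 3) (F : MvPolynomial (Fin 3) K) :
    (pderiv i F).totalDegree ≤ F.totalDegree - 1 := by
  rw [totalDegree, Finset.sup_le_iff]
  intro m hm
  rw [mem_support_iff, coeff_pderiv] at hm
  have h1 : coeff (m + Finsupp.single i 1) F ≠ 0 := left_ne_zero_of_mul hm
  have h2 := le_totalDegree (mem_support_iff.mpr h1)
  rw [Finsupp.sum_add_index' (by simp) (by simp)] at h2
  simp at h2
  omega

lemma exists_pderiv_ne {p : ℕ} [CharP K p] (F : MvPolynomial (Fin 3) K)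
    (h1 : 1 ≤ F.totalDegree) (h2 : F.totalDegree < p) : ∃ i, pderiv i F ≠ 0 := by
  by_contra! hcon
  have : F.totalDegree = 0 := by
    rw [totalDegree_eq_zero_iff]
    intro m hm i
    by_contra hmi
    have := congrArg (coeff (m - Finsupp.single i 1)) (hcon i)
    rw [coeff_pderiv, coeff_zero] at this
    have hle : Finsupp.single i 1 ≤ m := by
      rw [Finsupp.single_le_iff]; omega
    rw [tsub_add_cancel_of_le hle] at this
    rcases mul_eq_zero.mp this with h | h
    · exact (mem_support_iff.mp hm) h
    · have hh : (((m - Finsupp.single i 1 : Fin 3 →₀ ℕ) i : ℕ) : K) + 1 = ((m i : ℕ) : K) := by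
        simp only [Finsupp.tsub_apply, Finsupp.single_eq_same]
        exact_mod_cast congrArg (Nat.cast (R := K)) (show m i - 1 + 1 = m i by omega)
      rw [hh, CharP.cast_eq_zero_iff K p] at h
      have h3 := Nat.le_of_dvd (Nat.pos_of_ne_zero hmi) h
      have h4 := le_totalDegree hm
      have h5 : m i ≤ m.sum fun _ e => e := by
        rw [Finsupp.sum_fintype _ _ (by simp)]
        exact Finset.single_le_sum (f := fun i => m i) (by simp) (Finset.mem_univ i)
      omega
  omega

end GKL


namespace GKL

open MvPolynomial

variable {K : Type*} [Field K]

lemma exists_vanishing (X : Finset (Ln K)) (d : ℕ) (h : X.card * (d + 1) < (d + 3).choose 3) :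
    ∃ F : MvPolynomial (Fin 3) K, F ≠ 0 ∧ F.totalDegree ≤ d ∧ ∀ v ∈ X, res v F = 0 := by
  classical
  let φ : restrictTotalDegree (Fin 3) K d →ₗ[K] (X → Fin (d + 1) → K) :=
    LinearMap.pi fun v => LinearMap.pi fun i =>
      (Polynomial.lcoeff K (i : ℕ)) ∘ₗ (res v.1).toLinearMap ∘ₗ Submodule.subtype _
  have hφ : LinearMap.ker φ ≠ ⊥ := by
    apply LinearMap.ker_ne_bot_of_finrank_lt
    rw [finrank_V]
    simpa [Module.finrank_pi_fintype] using h
  obtain ⟨F, hF, hF0⟩ := Submodule.exists_mem_ne_zero_of_ne_bot hφ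
  have hdeg : F.1.totalDegree ≤ d := (mem_restrictTotalDegree _ _ _).mp F.2
  refine ⟨F.1, by simpa using hF0, hdeg, ?_⟩
  intro v hv
  ext i
  by_cases hi : i < d + 1
  · have := congrFun (congrFun (LinearMap.mem_ker.mp hF) ⟨v, hv⟩) ⟨i, hi⟩
    simpa [φ] using this
  · rw [Polynomial.coeff_eq_zero_of_natDegree_lt, Polynomial.coeff_zero]
    have := res_natDegree_le v F.1 hdeg
    omega

lemma exists_sep (v w : Ln K) (h : v ≠ w) :
    ∃ E : MvPolynomial (Fin 3) K, E.totalDegree ≤ 1 ∧ res w E = 0 ∧ res v E ≠ 0 := by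
  by_cases h1 : v.s = w.s ∧ v.β = w.β
  · refine ⟨X 2 - C (w.s ^ 2) * X 0 - C (w.s * w.β + w.e), ?_, ?_, ?_⟩
    · refine (totalDegree_sub_C_le _ _).trans ?_
      refine (totalDegree_sub _ _).trans ?_
      refine max_le (by simp) ((totalDegree_mul _ _).trans (by rw [totalDegree_C, totalDegree_X]))
    · simp only [map_sub, map_mul, res_C, res_X2, res_X0]; ring
    · simp only [map_sub, map_mul, res_C, res_X2, res_X0, h1.1, h1.2]
      intro h2
      have h3 : Polynomial.C (v.e - w.e) = 0 := by
        rw [← h2]; simp only [map_add, map_sub]; ring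
      rw [Polynomial.C_eq_zero, sub_eq_zero] at h3
      exact h (Ln.ext h1.1 h1.2 h3)
  · refine ⟨X 1 - C w.s * X 0 - C w.β, ?_, ?_, ?_⟩
    · refine (totalDegree_sub_C_le _ _).trans ?_
      refine (totalDegree_sub _ _).trans ?_
      refine max_le (by simp) ((totalDegree_mul _ _).trans (by rw [totalDegree_C, totalDegree_X]))
    · simp only [map_sub, map_mul, res_C, res_X1, res_X0]; ring
    · simp only [map_sub, map_mul, res_C, res_X1, res_X0]
      intro h2
      apply h1
      have h3 : Polynomial.C (v.s - w.s) * Polynomial.X + Polynomial.C (v.β - w.β) = 0 := by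
        rw [← h2]; simp only [map_sub]; ring
      have h4 := congrArg (fun q => Polynomial.coeff q 0) h3
      have h5 := congrArg (fun q => Polynomial.coeff q 1) h3
      simp [sub_eq_zero, Polynomial.coeff_C] at h4 h5
      exact ⟨h5, h4⟩

lemma exists_sepProd (L : Finset (Ln K)) (v : Ln K) :
    ∃ E : MvPolynomial (Fin 3) K, E.totalDegree ≤ L.card ∧ (∀ w ∈ L, w ≠ v → res w E = 0) ∧
      res v E ≠ 0 := by
  classical
  induction L using Finset.induction_on with
  | empty => exact ⟨1, by simp, by simp, by simp⟩
  | insert a L ha ih =>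
    obtain ⟨E, h1, h2, h3⟩ := ih
    by_cases hav : v = a
    · refine ⟨E, h1.trans (by simp [ha]), ?_, h3⟩
      intro w hw hwv
      rcases Finset.mem_insert.mp hw with h | h
      · exact absurd (h.trans hav.symm) hwv
      · exact h2 w h hwv
    · obtain ⟨E', g1, g2, g3⟩ := exists_sep v a hav
      refine ⟨E * E', ?_, ?_, ?_⟩
      · rw [Finset.card_insert_of_notMem ha]
        exact (totalDegree_mul _ _).trans (by omega)
      · intro w hw hwv
        rw [map_mul]
        rcases Finset.mem_insert.mp hw with h | h
        · rw [h, g2, mul_zero]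
        · rw [h2 w h hwv, zero_mul]
      · rw [map_mul]; exact mul_ne_zero h3 g3

lemma six_choose (n : ℕ) : 6 * (n + 3).choose 3 = (n + 1) * (n + 2) * (n + 3) := by
  have h := Nat.descFactorial_eq_factorial_mul_choose (n + 3) 3
  simp [Nat.descFactorial, Nat.factorial] at h
  rw [← h]; ring

lemma finrank_map_mul (F : MvPolynomial (Fin 3) K) (hF : F ≠ 0) (D : ℕ) :
    Module.finrank K ((restrictTotalDegree (Fin 3) K D).map (LinearMap.mulLeft K F)) =
      (D + 3).choose 3 := by
  rw [← finrank_V (K := K) D]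
  exact (LinearEquiv.finrank_eq (Submodule.equivMapOfInjective (LinearMap.mulLeft K F)
    (mul_right_injective₀ hF) (restrictTotalDegree (Fin 3) K D))).symm

lemma bezout_num (a b r M D : ℕ) (hr : a * b < r) (hM : M = a * b * (r + 1) + a + b)
    (hD0 : D = r + M) (key : (D - a + 3).choose 3 + (D - b + 3).choose 3 + r * (M + 1) ≤
    (D + 3).choose 3 + (D - a - b + 3).choose 3) : False := by
  have e1 := six_choose (D - a)
  have e2 := six_choose (D - b)
  have e3 := six_choose (D - a - b)
  have e4 := six_choose D
  obtain ⟨m, hm⟩ : ∃ m, D = m + a + b := ⟨D - a - b, by omega⟩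
  rw [hm] at e1 e2 e3 e4 key
  rw [show m + a + b - a = m + b by omega, show m + a + b - b = m + a by omega] at *
  rw [show m + b - b = m by omega] at *
  have key2 : (m + b + 1) * (m + b + 2) * (m + b + 3) + (m + a + 1) * (m + a + 2) * (m + a + 3) +
     6 * (r * (M + 1)) ≤ (m + a + b + 1) * (m + a + b + 2) * (m + a + b + 3) +
     (m + 1) * (m + 2) * (m + 3) := by omega
  have hD : m + a + b = r + M := by omega
  have key3 : 6 * (r * (M + 1)) ≤ 6 * (a * b) * (m + a + b + 2) := by
    have : 6 * (r * (M + 1)) + 3 * (a * b) * (a + b) ≤ 6 * (a * b) * (m + a + b + 2) := by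
      nlinarith [key2]
    omega
  rw [hD] at key3
  have h6 : (a * b + 1) * (M + 1) ≤ r * (M + 1) := Nat.mul_le_mul_right _ hr
  nlinarith

theorem bezout (F G : MvPolynomial (Fin 3) K) (hF : Irreducible F) (hG : ¬ F ∣ G)
    (L : Finset (Ln K)) (hLF : ∀ v ∈ L, res v F = 0) (hLG : ∀ v ∈ L, res v G = 0) :
    L.card ≤ F.totalDegree * G.totalDegree := by
  classical
  by_contra! hr
  have hF0 : F ≠ 0 := hF.ne_zero
  have hG0 : G ≠ 0 := fun h => hG (h ▸ dvd_zero F)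
  set a := F.totalDegree with ha
  set b := G.totalDegree with hb
  set r := L.card with hrdef
  obtain ⟨M, hM⟩ : ∃ M, M = a * b * (r + 1) + a + b := ⟨_, rfl⟩
  obtain ⟨D, hD⟩ : ∃ D, D = r + M := ⟨_, rfl⟩
  choose E hE1 hE2 hE3 using exists_sepProd (K := K) L
  let V := restrictTotalDegree (Fin 3) K
  let A := (V (D - a)).map (LinearMap.mulLeft K F)
  let B := (V (D - b)).map (LinearMap.mulLeft K G)
  let I := (V (D - a - b)).map (LinearMap.mulLeft K (F * G))
  have hI : A ⊓ B ≤ I := by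
    rintro x ⟨⟨P, hP, rfl⟩, ⟨Q, hQ, hPQ⟩⟩
    simp only [LinearMap.mulLeft_apply] at hPQ ⊢
    have hdvd : F ∣ G * Q := ⟨P, hPQ⟩
    rcases hF.prime.dvd_or_dvd hdvd with h | h
    · exact absurd h hG
    · obtain ⟨H, rfl⟩ := h
      refine ⟨H, ?_, ?_⟩
      · have hQ' := (mem_restrictTotalDegree _ _ _).mp hQ
        show H ∈ restrictTotalDegree (Fin 3) K (D - a - b)
        rw [mem_restrictTotalDegree]
        by_cases hH : H = 0
        · simp [hH]
        rw [totalDegree_mul_of_isDomain hF0 hH] at hQ'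
        omega
      · simp only [LinearMap.mulLeft_apply]
        rw [← hPQ]; ring
  let σ : (L → Fin (M + 1) → K) →ₗ[K] MvPolynomial (Fin 3) K :=
    ∑ v : L, LinearMap.mulLeft K (E v.1) ∘ₗ
      (∑ i : Fin (M + 1), LinearMap.mulRight K (X 0 ^ (i : ℕ)) ∘ₗ
        (Algebra.linearMap K (MvPolynomial (Fin 3) K)) ∘ₗ LinearMap.proj i) ∘ₗ LinearMap.proj v
  have hσ : ∀ c, σ c = ∑ v : L, E v.1 * ∑ i : Fin (M + 1), C (c v i) * X 0 ^ (i : ℕ) := by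
    intro c
    simp [σ, MvPolynomial.algebraMap_eq, Finset.mul_sum]
  have hres : ∀ c, ∀ v : L, res v.1 (σ c) = res v.1 (E v.1) *
      ∑ i : Fin (M + 1), Polynomial.C (c v i) * Polynomial.X ^ (i : ℕ) := by
    intro c v
    rw [hσ, map_sum, Finset.sum_eq_single v]
    · simp only [map_mul, map_sum, map_pow, res_C, res_X0]
    · intro w _ hw
      rw [map_mul, hE2 w.1 v.1 v.2 (fun h => hw (Subtype.ext h.symm)), zero_mul]
    · simp
  have hzero : ∀ c, (∀ v : L, res v.1 (σ c) = 0) → c = 0 := by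
    intro c hc
    funext v i
    have h1 := hc v
    rw [hres] at h1
    have h2 := (mul_eq_zero.mp h1).resolve_left (hE3 v.1)
    have h3 := congrArg (fun q => Polynomial.coeff q (i : ℕ)) h2
    simp only [Polynomial.finsetSum_coeff, Polynomial.coeff_C_mul, Polynomial.coeff_X_pow,
      Polynomial.coeff_zero] at h3
    rw [Finset.sum_eq_single i] at h3
    · simpa using h3
    · intro j _ hj
      have : (i : ℕ) ≠ j := fun h => hj (Fin.ext h.symm)
      simp [this]
    · simp
  have hσinj : Function.Injective σ := by
    rw [← LinearMap.ker_eq_bot, LinearMap.ker_eq_bot']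
    intro c hc
    exact hzero c (fun v => by rw [hc, map_zero])
  let S := LinearMap.range σ
  have hS : (A ⊔ B) ⊓ S = ⊥ := by
    rw [eq_bot_iff]
    rintro x ⟨hx, ⟨c, rfl⟩⟩
    obtain ⟨y, ⟨P, hP, rfl⟩, z, ⟨Q, hQ, rfl⟩, hyz⟩ := Submodule.mem_sup.mp hx
    have : c = 0 := by
      apply hzero
      intro v
      rw [← hyz]
      simp [hLF v.1 v.2, hLG v.1 v.2]
    simp [this]
  have hle : (A ⊔ B) ⊔ S ≤ V D := by
    refine sup_le (sup_le ?_ ?_) ?_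
    · rintro x ⟨P, hP, rfl⟩
      have hP' := (mem_restrictTotalDegree _ _ _).mp hP
      rw [mem_restrictTotalDegree]
      exact (totalDegree_mul _ _).trans (by omega)
    · rintro x ⟨P, hP, rfl⟩
      have hP' := (mem_restrictTotalDegree _ _ _).mp hP
      rw [mem_restrictTotalDegree]
      exact (totalDegree_mul _ _).trans (by omega)
    · rintro x ⟨c, rfl⟩
      rw [hσ, mem_restrictTotalDegree]
      refine totalDegree_finsetSum_le (fun v _ => ?_)
      refine (totalDegree_mul _ _).trans ?_
      refine (add_le_add (hE1 v.1) (?_ : _ ≤ M)).trans (by omega)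
      refine totalDegree_finsetSum_le (fun i _ => ?_)
      refine (totalDegree_mul _ _).trans ?_
      have := i.2
      simp only [totalDegree_C, totalDegree_X_pow]
      omega
  have d1 := Submodule.finrank_sup_add_finrank_inf_eq (A ⊔ B) S
  have d2 := Submodule.finrank_sup_add_finrank_inf_eq A B
  have d3 : Module.finrank K ↥(A ⊓ B) ≤ Module.finrank K I := Submodule.finrank_mono hI
  have d4 : Module.finrank K ↥((A ⊔ B) ⊔ S) ≤ Module.finrank K (V D) := Submodule.finrank_mono hle
  have d5 : Module.finrank K S = r * (M + 1) := by
    rw [LinearMap.finrank_range_of_inj hσinj]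
    simp [Module.finrank_pi_fintype, hrdef]
  rw [hS, finrank_bot, d5] at d1
  rw [finrank_map_mul F hF0, finrank_map_mul G hG0] at d2
  rw [finrank_map_mul (F * G) (mul_ne_zero hF0 hG0)] at d3
  rw [finrank_V] at d4
  exact bezout_num a b r M D hr hM hD (by omega)

end GKL


namespace GKL

open Polynomial

variable {K : Type*} [Field K]

/-- ODE lemma at zero -/
lemma ode_zero {p : ℕ} [CharP K p] (P U : K[X]) (hP : P.eval 0 ≠ 0) (hU0 : U.coeff 0 = 0)
    (hU1 : U.coeff 1 = 0) (hdeg : U.natDegree < p)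
    (h : P * (derivative (derivative P) * U - derivative (derivative U) * P) =
      2 * derivative P * (derivative P * U - derivative U * P)) : U = 0 := by
  by_contra hU
  obtain ⟨k, hk⟩ : ∃ k, k = U.natTrailingDegree := ⟨_, rfl⟩
  have hc : U.coeff k ≠ 0 := by rw [hk]; exact (coeff_natTrailingDegree_ne_zero).mpr hU
  have hk2 : 2 ≤ k := by
    by_contra! hlt
    interval_cases k
    · exact hc hU0
    · exact hc hU1
  obtain ⟨j, rfl⟩ : ∃ j, k = j + 2 := ⟨k - 2, by omega⟩
  obtain ⟨W, hW⟩ : X ^ (j + 2) ∣ U := by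
    rw [X_pow_dvd_iff]
    intro i hi
    exact coeff_eq_zero_of_lt_natTrailingDegree (by omega)
  have hkd : j + 2 < p := lt_of_le_of_lt (by rw [hk]; exact natTrailingDegree_le_natDegree U) hdeg
  have hW0 : W.eval 0 ≠ 0 := by
    rw [hW, coeff_X_pow_mul'] at hc
    simpa [coeff_zero_eq_eval_zero] using hc
  -- plug in
  have hX : (X ^ j : K[X]) ≠ 0 := pow_ne_zero _ X_ne_zero
  have hd1 : derivative U = X ^ (j+1) * (((j : K[X]) + 2) * W + X * derivative W) := by
    rw [hW, derivative_mul, derivative_X_pow]; push_cast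
    simp only [map_add, map_natCast, map_ofNat, map_one]
    ring_nf
  have hd2 : derivative (derivative U) = X ^ j * (((j : K[X]) + 2) * ((j : K[X]) + 1) * W +
      X * (((j : K[X]) + 1) * derivative W + derivative (((j : K[X]) + 2) * W + X * derivative W))) := by
    rw [hd1, derivative_mul, derivative_X_pow]; push_cast
    simp only [map_add, map_natCast, map_ofNat, map_one]
    ring
  rw [hd2, hd1, hW] at h
  have h2 : P * (derivative (derivative P) * (X ^ 2 * W) - (((j : K[X]) + 2) * ((j : K[X]) + 1) * W +
      X * (((j : K[X]) + 1) * derivative W + derivative (((j : K[X]) + 2) * W + X * derivative W))) * P) =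
      2 * derivative P * (derivative P * (X ^ 2 * W) - (X * (((j : K[X]) + 2) * W + X * derivative W)) * P) := by
    apply mul_left_cancel₀ hX
    linear_combination h
  have h3 := congrArg (Polynomial.eval 0) h2
  simp only [eval_mul, eval_sub, eval_add, eval_pow, eval_X, eval_natCast, eval_ofNat, eval_one] at h3
  ring_nf at h3
  have h4 : ((j : K) + 2) * (j + 1) * (P.eval 0 ^2 * W.eval 0) = 0 := by
    linear_combination -h3
  have h5 : (j : K) + 2 ≠ 0 := by
    have : ((j + 2 : ℕ) : K) ≠ 0 := by
      rw [Ne, CharP.cast_eq_zero_iff K p]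
      exact fun h => by have := Nat.le_of_dvd (by omega) h; omega
    simpa using this
  have h6 : (j : K) + 1 ≠ 0 := by
    have : ((j + 1 : ℕ) : K) ≠ 0 := by
      rw [Ne, CharP.cast_eq_zero_iff K p]
      exact fun h => by have := Nat.le_of_dvd (by omega) h; omega
    simpa using this
  exact mul_ne_zero (mul_ne_zero h5 h6) (mul_ne_zero (pow_ne_zero 2 hP) hW0) h4

lemma ode {p : ℕ} [CharP K p] (P c : K[X]) (t1 : K) (hP : P.eval t1 ≠ 0)
    (hPd : P.natDegree + 1 < p) (hc : c.natDegree < p)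
    (h : P * (derivative (derivative P) * c - derivative (derivative c) * P) =
      2 * derivative P * (derivative P * c - derivative c * P)) :
    ∃ l n : K, c = (C l * X + C n) * P := by
  -- translate to zero
  obtain ⟨P0, hP0⟩ : ∃ P0, P0 = P.comp (X + C t1) := ⟨_, rfl⟩
  obtain ⟨c0, hc0⟩ : ∃ c0, c0 = c.comp (X + C t1) := ⟨_, rfl⟩
  have hdc : ∀ q : K[X], derivative (q.comp (X + C t1)) = (derivative q).comp (X + C t1) := by
    intro q; simp [derivative_comp]
  have hP00 : P0.coeff 0 ≠ 0 := by
    rw [hP0, coeff_zero_eq_eval_zero]; simpa [eval_comp] using hP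
  have h0 := congrArg (fun q => q.comp (X + C t1)) h
  simp only [mul_comp, sub_comp, ← hdc, ← hP0, ← hc0] at h0
  have h2 : (2 : K[X]).comp (X + C t1) = 2 := by simp
  rw [h2] at h0
  obtain ⟨n, hn⟩ : ∃ n, n = c0.coeff 0 / P0.coeff 0 := ⟨_, rfl⟩
  obtain ⟨l, hl⟩ : ∃ l, l = (c0.coeff 1 - n * P0.coeff 1) / P0.coeff 0 := ⟨_, rfl⟩
  have hU : c0 - (C l * X + C n) * P0 = 0 := by
    apply ode_zero (p := p) P0
    · rwa [← coeff_zero_eq_eval_zero]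
    · simp [add_mul, mul_assoc, hn, hP00]
    · have hx : (X * P0).coeff 1 = P0.coeff 0 := coeff_X_mul P0 0
      simp only [add_mul, mul_assoc, coeff_sub, coeff_add, coeff_C_mul, hx]
      rw [hl]; field_simp; ring
    · refine lt_of_le_of_lt (natDegree_sub_le _ _) ?_
      rw [max_lt_iff]
      constructor
      · rw [hc0, natDegree_comp]; simpa using hc
      · refine lt_of_le_of_lt natDegree_mul_le ?_
        have : P0.natDegree = P.natDegree := by rw [hP0, natDegree_comp]; simp
        have h3 := natDegree_linear_le (R := K) (a := l) (b := n)
        omega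
    · simp only [derivative_sub, derivative_mul, derivative_add, derivative_X, derivative_C,
        derivative_zero, derivative_one]
      linear_combination h0
  refine ⟨l, n - l * t1, ?_⟩
  have h3 := congrArg (fun q => q.comp (X - C t1)) hU
  have h4 : ∀ q : K[X], (q.comp (X + C t1)).comp (X - C t1) = q := by
    intro q; rw [comp_assoc]; simp
  simp only [sub_comp, mul_comp, add_comp, hc0, hP0, h4, C_comp, X_comp, zero_comp] at h3
  rw [map_sub, map_mul]
  linear_combination h3

end GKL


namespace GKL

open MvPolynomial

variable {K : Type*} [Field K]

/-- parameter of the meeting point -/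
def tt (v w : Ln K) : K := (w.β - v.β) / (v.s - w.s)

def Meet (v w : Ln K) : Prop := v.s ≠ w.s ∧ v.e - w.e = w.s * v.β - v.s * w.β

lemma Meet.pt_eq {v w : Ln K} (h : Meet v w) : pt v (tt v w) = pt w (tt v w) := by
  have h1 : v.s - w.s ≠ 0 := sub_ne_zero.mpr h.1
  have h2 : (v.s - w.s) * tt v w = w.β - v.β := by
    rw [tt]; field_simp
  have h3 := h.2
  unfold pt
  congr 1
  congr 1
  · linear_combination h2
  · congr 1
    linear_combination (v.s + w.s) * h2 + h3

lemma Meet.eval_eq {v w : Ln K} (h : Meet v w) (F : MvPolynomial (Fin 3) K) :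
    (res v F).eval (tt v w) = (res w F).eval (tt v w) := by
  rw [eval_res, eval_res, h.pt_eq]

lemma poly_zero_of_many (v : Ln K) (T : Finset (Ln K)) (hinj : Set.InjOn (tt v) T)
    (q : Polynomial K) {m : ℕ} (hq : q.natDegree ≤ m) (hT : ∀ w ∈ T, q.eval (tt v w) = 0)
    (hm : m < T.card) : q = 0 := by
  classical
  apply Polynomial.eq_zero_of_natDegree_lt_card_of_eval_eq_zero' q (T.image (tt v))
  · intro x hx
    obtain ⟨w, hw, rfl⟩ := Finset.mem_image.mp hx
    exact hT w hw
  · rw [Finset.card_image_of_injOn hinj]; omega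

/-- number of neighbours where a nonzero polynomial vanishes -/
lemma card_zeros_le (v : Ln K) (T : Finset (Ln K)) (hinj : Set.InjOn (tt v) T)
    (q : Polynomial K) (hq0 : q ≠ 0) {m : ℕ} (hq : q.natDegree ≤ m)
    (hT : ∀ w ∈ T, q.eval (tt v w) = 0) : T.card ≤ m := by
  by_contra! h
  exact hq0 (poly_zero_of_many v T hinj q hq hT h)

lemma vanish_of_many (v : Ln K) (T : Finset (Ln K)) (hinj : Set.InjOn (tt v) T)
    (hmeet : ∀ w ∈ T, Meet v w)
    (F : MvPolynomial (Fin 3) K) {m : ℕ} (hF : F.totalDegree ≤ m) (hT : ∀ w ∈ T, res w F = 0)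
    (hm : m < T.card) : res v F = 0 := by
  apply poly_zero_of_many v T hinj _ (res_natDegree_le v F hF) _ hm
  intro w hw
  rw [(hmeet w hw).eval_eq, hT w hw, Polynomial.eval_zero]

section pseudo
variable {R : Type*} [CommRing R]

def G2 (c c4 : R) : R := c ^ 2 * c4
def G1 (b c c3 c4 : R) : R := c ^ 2 * c3 - b * c * c4
def G0 (a b c c2 c3 c4 : R) : R := c ^ 2 * c2 - b * (c * c3 - b * c4) - a * c * c4
def R1 (a b c c1 c2 c3 c4 : R) : R := c ^ 3 * c1 - b * G0 a b c c2 c3 c4 - a * G1 b c c3 c4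
def R0 (a b c c0 c2 c3 c4 : R) : R := c ^ 3 * c0 - a * G0 a b c c2 c3 c4

lemma pseudo_id (a b c c0 c1 c2 c3 c4 s : R) :
    c ^ 3 * (c0 + c1 * s + c2 * s ^ 2 + c3 * s ^ 3 + c4 * s ^ 4) =
      (G0 a b c c2 c3 c4 + G1 b c c3 c4 * s + G2 c c4 * s ^ 2) * (a + s * b + s ^ 2 * c) +
      R1 a b c c1 c2 c3 c4 * s + R0 a b c c0 c2 c3 c4 := by
  simp only [R0, R1, G0, G1, G2]; ring

lemma pseudo_id' (a b c c1 c2 c3 c4 s : R) :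
    c ^ 3 * (c1 + 2 * c2 * s + 3 * c3 * s ^ 2 + 4 * c4 * s ^ 3) =
      (G0 a b c c2 c3 c4 + G1 b c c3 c4 * s + G2 c c4 * s ^ 2) * (b + 2 * s * c) +
      (G1 b c c3 c4 + 2 * G2 c c4 * s) * (a + s * b + s ^ 2 * c) +
      R1 a b c c1 c2 c3 c4 := by
  simp only [R1, G0, G1, G2]; ring

end pseudo

/-- directional derivative -/
noncomputable def DV (s : K) (F : MvPolynomial (Fin 3) K) : MvPolynomial (Fin 3) K :=
  pderiv 0 F + C s * pderiv 1 F + C (s ^ 2) * pderiv 2 F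

lemma derivative_res' (v : Ln K) (F : MvPolynomial (Fin 3) K) :
    Polynomial.derivative (res v F) = res v (DV v.s F) := derivative_res v F

lemma DV_pderiv (s : K) (i : Fin 3) (F : MvPolynomial (Fin 3) K) :
    DV s (pderiv i F) = pderiv i (DV s F) := by
  simp only [DV, map_add, pderiv_C_mul, pderiv_comm i]

noncomputable def k0 (F : MvPolynomial (Fin 3) K) := pderiv 0 (pderiv 0 F)
noncomputable def k1 (F : MvPolynomial (Fin 3) K) := C 2 * pderiv 0 (pderiv 1 F)
noncomputable def k2 (F : MvPolynomial (Fin 3) K) :=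
  pderiv 1 (pderiv 1 F) + C 2 * pderiv 0 (pderiv 2 F)
noncomputable def k3 (F : MvPolynomial (Fin 3) K) := C 2 * pderiv 1 (pderiv 2 F)
noncomputable def k4 (F : MvPolynomial (Fin 3) K) := pderiv 2 (pderiv 2 F)

lemma DV_DV (s : K) (F : MvPolynomial (Fin 3) K) :
    DV s (DV s F) = k0 F + k1 F * C s + k2 F * C s ^ 2 + k3 F * C s ^ 3 + k4 F * C s ^ 4 := by
  simp only [DV, map_add, pderiv_C_mul, k0, k1, k2, k3, k4, pderiv_comm 1 0, pderiv_comm 2 0,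
    pderiv_comm 2 1]
  simp only [map_pow]
  rw [show (C 2 : MvPolynomial (Fin 3) K) = 2 from map_ofNat _ 2]
  ring

lemma DV_eq (s : K) (F : MvPolynomial (Fin 3) K) :
    DV s F = pderiv 0 F + C s * pderiv 1 F + C s ^ 2 * pderiv 2 F := by
  simp [DV]

noncomputable def RR1 (F : MvPolynomial (Fin 3) K) :=
  R1 (pderiv 0 F) (pderiv 1 F) (pderiv 2 F) (k1 F) (k2 F) (k3 F) (k4 F)
noncomputable def RR0 (F : MvPolynomial (Fin 3) K) :=
  R0 (pderiv 0 F) (pderiv 1 F) (pderiv 2 F) (k0 F) (k2 F) (k3 F) (k4 F)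
noncomputable def GG (s : K) (F : MvPolynomial (Fin 3) K) :=
  G0 (pderiv 0 F) (pderiv 1 F) (pderiv 2 F) (k2 F) (k3 F) (k4 F) +
    G1 (pderiv 1 F) (pderiv 2 F) (k3 F) (k4 F) * C s + G2 (pderiv 2 F) (k4 F) * C s ^ 2

lemma pseudo_F (s : K) (F : MvPolynomial (Fin 3) K) :
    pderiv 2 F ^ 3 * DV s (DV s F) = GG s F * DV s F + RR1 F * C s + RR0 F := by
  rw [DV_DV, DV_eq]
  exact pseudo_id _ _ _ _ _ _ _ _ _

/-- the polynomial `B + 2 s C` -/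
noncomputable def PP (s : K) (F : MvPolynomial (Fin 3) K) := pderiv 1 F + C (2 * s) * pderiv 2 F

lemma pseudo_F' (s : K) (F : MvPolynomial (Fin 3) K) :
    pderiv 2 F ^ 3 * (2 * DV s (PP s F)) = GG s F * PP s F +
      (G1 (pderiv 1 F) (pderiv 2 F) (k3 F) (k4 F) + 2 * G2 (pderiv 2 F) (k4 F) * C s) * DV s F
      + RR1 F := by
  have h := pseudo_id' (pderiv 0 F) (pderiv 1 F) (pderiv 2 F) (k1 F) (k2 F) (k3 F) (k4 F) (C s)
  have h2 : (C (2 * s) : MvPolynomial (Fin 3) K) = 2 * C s := by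
    rw [map_mul]; congr 1; 
  have h3 : 2 * DV s (PP s F) = k1 F + 2 * k2 F * C s + 3 * k3 F * C s ^ 2 + 4 * k4 F * C s ^ 3 := by
    simp only [DV, PP, map_add, pderiv_C_mul, k1, k2, k3, k4, pderiv_comm 1 0, pderiv_comm 2 0,
      pderiv_comm 2 1, map_pow]
    rw [h2, show (C 2 : MvPolynomial (Fin 3) K) = 2 from map_ofNat _ 2]
    ring
  rw [h3, h, DV_eq, PP, h2]
  simp only [GG, RR1]

section deg
lemma td_mul {x y : MvPolynomial (Fin 3) K} {i j n : ℕ} (hx : x.totalDegree ≤ i)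
    (hy : y.totalDegree ≤ j) (h : i + j ≤ n) : (x * y).totalDegree ≤ n :=
  (totalDegree_mul _ _).trans (by omega)
lemma td_sub {x y : MvPolynomial (Fin 3) K} {n : ℕ} (hx : x.totalDegree ≤ n)
    (hy : y.totalDegree ≤ n) : (x - y).totalDegree ≤ n :=
  (totalDegree_sub _ _).trans (by omega)
lemma td_add {x y : MvPolynomial (Fin 3) K} {n : ℕ} (hx : x.totalDegree ≤ n)
    (hy : y.totalDegree ≤ n) : (x + y).totalDegree ≤ n :=
  (totalDegree_add _ _).trans (by omega)
lemma td_C {a : K} {n : ℕ} : (C a : MvPolynomial (Fin 3) K).totalDegree ≤ n := by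
  rw [totalDegree_C]; omega
lemma td_pd {x : MvPolynomial (Fin 3) K} {n : ℕ} (i : Fin 3) (hx : x.totalDegree ≤ n) :
    (pderiv i x).totalDegree ≤ n := (totalDegree_pderiv i x).trans (by omega)

lemma td_G0 {a b c c2 c3 c4 : MvPolynomial (Fin 3) K} {m : ℕ} (ha : a.totalDegree ≤ m)
    (hb : b.totalDegree ≤ m) (hc : c.totalDegree ≤ m) (h2 : c2.totalDegree ≤ m)
    (h3 : c3.totalDegree ≤ m) (h4 : c4.totalDegree ≤ m) :
    (G0 a b c c2 c3 c4).totalDegree ≤ 3 * m := by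
  unfold G0
  have hcc : (c ^ 2).totalDegree ≤ 2 * m := (totalDegree_pow _ _).trans (by omega)
  refine td_sub (td_sub (td_mul hcc h2 (by omega)) ?_) ?_
  · exact td_mul hb (td_sub (td_mul hc h3 le_rfl) (td_mul hb h4 le_rfl)) (by omega)
  · exact td_mul (td_mul ha hc le_rfl) h4 (by omega)

lemma td_G1 {b c c3 c4 : MvPolynomial (Fin 3) K} {m : ℕ}
    (hb : b.totalDegree ≤ m) (hc : c.totalDegree ≤ m)
    (h3 : c3.totalDegree ≤ m) (h4 : c4.totalDegree ≤ m) :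
    (G1 b c c3 c4).totalDegree ≤ 3 * m := by
  unfold G1
  have hcc : (c ^ 2).totalDegree ≤ 2 * m := (totalDegree_pow _ _).trans (by omega)
  exact td_sub (td_mul hcc h3 (by omega)) (td_mul (td_mul hb hc le_rfl) h4 (by omega))

lemma td_k0 (F : MvPolynomial (Fin 3) K) : (k0 F).totalDegree ≤ F.totalDegree :=
  td_pd _ (td_pd _ le_rfl)
lemma td_k1 (F : MvPolynomial (Fin 3) K) : (k1 F).totalDegree ≤ F.totalDegree :=
  td_mul (td_C (n := 0)) (td_pd _ (td_pd _ le_rfl)) (by omega)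
lemma td_k2 (F : MvPolynomial (Fin 3) K) : (k2 F).totalDegree ≤ F.totalDegree :=
  td_add (td_pd _ (td_pd _ le_rfl)) (td_mul (td_C (n := 0)) (td_pd _ (td_pd _ le_rfl)) (by omega))
lemma td_k3 (F : MvPolynomial (Fin 3) K) : (k3 F).totalDegree ≤ F.totalDegree :=
  td_mul (td_C (n := 0)) (td_pd _ (td_pd _ le_rfl)) (by omega)
lemma td_k4 (F : MvPolynomial (Fin 3) K) : (k4 F).totalDegree ≤ F.totalDegree :=
  td_pd _ (td_pd _ le_rfl)

lemma td_RR0 (F : MvPolynomial (Fin 3) K) : (RR0 F).totalDegree ≤ 4 * F.totalDegree := by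
  unfold RR0 R0
  have hc : (pderiv 2 F ^ 3).totalDegree ≤ 3 * F.totalDegree :=
    (totalDegree_pow _ _).trans (Nat.mul_le_mul_left _ (td_pd _ le_rfl))
  refine td_sub (td_mul hc (td_k0 F) (by omega)) ?_
  exact td_mul (td_pd _ le_rfl) (td_G0 (td_pd _ le_rfl) (td_pd _ le_rfl) (td_pd _ le_rfl)
    (td_k2 F) (td_k3 F) (td_k4 F)) (by omega)

lemma td_RR1 (F : MvPolynomial (Fin 3) K) : (RR1 F).totalDegree ≤ 4 * F.totalDegree := by
  unfold RR1 R1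
  have hc : (pderiv 2 F ^ 3).totalDegree ≤ 3 * F.totalDegree :=
    (totalDegree_pow _ _).trans (Nat.mul_le_mul_left _ (td_pd _ le_rfl))
  refine td_sub (td_sub (td_mul hc (td_k1 F) (by omega)) ?_) ?_
  · exact td_mul (td_pd _ le_rfl) (td_G0 (td_pd _ le_rfl) (td_pd _ le_rfl) (td_pd _ le_rfl)
      (td_k2 F) (td_k3 F) (td_k4 F)) (by omega)
  · exact td_mul (td_pd _ le_rfl) (td_G1 (td_pd _ le_rfl) (td_pd _ le_rfl)
      (td_k3 F) (td_k4 F)) (by omega)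
end deg

end GKL


namespace GKL

open MvPolynomial

variable {K : Type*} [Field K]

/-- first order information at a meeting point of two lines in `Z(F)` -/
lemma meet_first {v w : Ln K} (h : Meet v w) (F : MvPolynomial (Fin 3) K)
    (hv : res v F = 0) (hw : res w F = 0) :
    (res v (PP v.s F)).eval (tt v w) + (w.s - v.s) * (res v (pderiv 2 F)).eval (tt v w) = 0 := by
  have h1 : (res v (DV v.s F)).eval (tt v w) = 0 := by
    rw [← derivative_res', hv]; simp
  have h2 : (res v (DV w.s F)).eval (tt v w) = 0 := by
    rw [h.eval_eq, ← derivative_res', hw]; simp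
  simp only [DV, PP, map_add, map_mul, res_C, Polynomial.eval_add, Polynomial.eval_mul,
    Polynomial.eval_C] at h1 h2 ⊢
  have h3 : w.s - v.s ≠ 0 := sub_ne_zero.mpr (Ne.symm h.1)
  apply mul_left_cancel₀ h3
  linear_combination h2 - h1

lemma meet_second {v w : Ln K} (h : Meet v w) (F : MvPolynomial (Fin 3) K)
    (hv : res v F = 0) (hw : res w F = 0) :
    (res v (RR1 F)).eval (tt v w) = 0 ∧ (res v (RR0 F)).eval (tt v w) = 0 := by
  have h1 : (res v (DV v.s F)).eval (tt v w) = 0 := by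
    rw [← derivative_res', hv]; simp
  have h2 : (res v (DV w.s F)).eval (tt v w) = 0 := by
    rw [h.eval_eq, ← derivative_res', hw]; simp
  have h3 : (res v (DV v.s (DV v.s F))).eval (tt v w) = 0 := by
    rw [← derivative_res', ← derivative_res', hv]; simp
  have h4 : (res v (DV w.s (DV w.s F))).eval (tt v w) = 0 := by
    rw [h.eval_eq, ← derivative_res', ← derivative_res', hw]; simp
  have e1 := congrArg (fun q => (res v q).eval (tt v w)) (pseudo_F v.s F)
  have e2 := congrArg (fun q => (res v q).eval (tt v w)) (pseudo_F w.s F)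
  simp only [map_add, map_mul, res_C, Polynomial.eval_add, Polynomial.eval_mul,
    Polynomial.eval_C, h1, h2, h3, h4, mul_zero, zero_add] at e1 e2
  have h5 : w.s - v.s ≠ 0 := sub_ne_zero.mpr (Ne.symm h.1)
  have h6 : (res v (RR1 F)).eval (tt v w) = 0 := by
    apply mul_left_cancel₀ h5
    linear_combination e1 - e2
  refine ⟨h6, ?_⟩
  rw [h6] at e1
  linear_combination -e1

lemma local_flat (F : MvPolynomial (Fin 3) K) (v : Ln K) (T : Finset (Ln K))
    (hinj : Set.InjOn (tt v) T) (hT : ∀ w ∈ T, Meet v w ∧ res w F = 0) (hv : res v F = 0)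
    (hcard : 4 * F.totalDegree < T.card) : res v (RR1 F) = 0 ∧ res v (RR0 F) = 0 := by
  constructor
  · exact poly_zero_of_many v T hinj _ (res_natDegree_le v _ (td_RR1 F))
      (fun w hw => (meet_second (hT w hw).1 F hv (hT w hw).2).1) hcard
  · exact poly_zero_of_many v T hinj _ (res_natDegree_le v _ (td_RR0 F))
      (fun w hw => (meet_second (hT w hw).1 F hv (hT w hw).2).2) hcard

lemma td_PP (s : K) (F : MvPolynomial (Fin 3) K) :
    (PP s F).totalDegree ≤ F.totalDegree - 1 :=
  td_add (totalDegree_pderiv _ _)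
    (td_mul (td_C (n := 0)) (totalDegree_pderiv _ _) (by omega))

lemma local_ne (F : MvPolynomial (Fin 3) K) (v : Ln K) (T : Finset (Ln K))
    (hinj : Set.InjOn (tt v) T) (hT : ∀ w ∈ T, Meet v w ∧ res w F = 0) (hv : res v F = 0)
    (hgrad : ∃ i, res v (pderiv i F) ≠ 0)
    (hcard : F.totalDegree < T.card) : res v (pderiv 2 F) ≠ 0 ∧ res v (PP v.s F) ≠ 0 := by
  have h0 : res v (DV v.s F) = 0 := by rw [← derivative_res', hv]; simp
  have hc : res v (pderiv 2 F) ≠ 0 := by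
    intro hc
    have hP : res v (PP v.s F) = 0 := by
      apply poly_zero_of_many v T hinj _ (res_natDegree_le v _ (td_PP v.s F)) _ (by omega)
      intro w hw
      have := meet_first (hT w hw).1 F hv (hT w hw).2
      simpa [hc] using this
    have hb : res v (pderiv 1 F) = 0 := by
      simpa [PP, hc] using hP
    have ha : res v (pderiv 0 F) = 0 := by
      simpa [DV, hc, hb] using h0
    obtain ⟨i, hi⟩ := hgrad
    fin_cases i
    · exact hi ha
    · exact hi hb
    · exact hi hc
  refine ⟨hc, fun hP => hc ?_⟩
  apply poly_zero_of_many v T hinj _ (res_natDegree_le v _ (td_pd 2 le_rfl)) _ hcard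
  intro w hw
  have := meet_first (hT w hw).1 F hv (hT w hw).2
  rw [hP] at this
  simpa [sub_eq_zero, (hT w hw).1.1.symm] using this

/-- the differential equation along a line -/
lemma local_ode (F : MvPolynomial (Fin 3) K) (v : Ln K) (hv : res v F = 0)
    (h0 : F ∣ RR0 F) (h1 : F ∣ RR1 F) (hc : res v (pderiv 2 F) ≠ 0) (P c : Polynomial K)
    (hP : P = res v (PP v.s F)) (hcc : c = res v (pderiv 2 F)) :
    P * (Polynomial.derivative (Polynomial.derivative P) * c -
        Polynomial.derivative (Polynomial.derivative c) * P) =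
      2 * Polynomial.derivative P * (Polynomial.derivative P * c -
        Polynomial.derivative c * P) := by
  obtain ⟨S0, hS0⟩ := h0
  obtain ⟨S1, hS1⟩ := h1
  have hq : res v (DV v.s F) = 0 := by rw [← derivative_res', hv]; simp
  have hQ : res v (DV v.s (DV v.s F)) = 0 := by rw [← derivative_res', hq]; simp
  have key : ∀ i, c ^ 3 * Polynomial.derivative (Polynomial.derivative (res v (pderiv i F))) -
      res v (GG v.s F) * Polynomial.derivative (res v (pderiv i F)) =
      res v (pderiv i F) * res v (S1 * C v.s + S0) := by
    intro i
    have e := pseudo_F v.s F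
    rw [hS0, hS1] at e
    have e2 := congrArg (fun q => res v (pderiv i q)) e
    simp only [map_add, pderiv_mul, map_mul, hq, hQ, hv, mul_zero, add_zero, zero_mul,
      zero_add, map_pow] at e2
    rw [derivative_res', derivative_res', DV_pderiv, DV_pderiv, hcc, map_add, map_mul]
    linear_combination e2
  have keyP : c ^ 3 * Polynomial.derivative (Polynomial.derivative P) -
      res v (GG v.s F) * Polynomial.derivative P = P * res v (S1 * C v.s + S0) := by
    have e1 := key 1
    have e2 := key 2
    rw [hP, PP, map_add, map_mul, res_C]
    simp only [Polynomial.derivative_add, Polynomial.derivative_mul, Polynomial.derivative_C,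
      zero_mul, zero_add]
    linear_combination e1 + Polynomial.C (2 * v.s) * e2
  have keyc := key 2
  rw [← hcc] at keyc
  have e3 := congrArg (res v) (pseudo_F' v.s F)
  have hr1 : res v (RR1 F) = 0 := by rw [hS1, map_mul, hv, zero_mul]
  simp only [map_add, map_mul, hq, hr1, mul_zero, add_zero, map_pow, ← hP, ← hcc,
    ← derivative_res', map_ofNat] at e3
  have hc3 : c ^ 3 ≠ 0 := pow_ne_zero 3 (hcc ▸ hc)
  apply mul_left_cancel₀ hc3
  linear_combination P * c * keyP - P * P * keyc -
    (Polynomial.derivative P * c - Polynomial.derivative c * P) * e3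

theorem local_final {p : ℕ} [CharP K p] [DecidableEq K]
    (F : MvPolynomial (Fin 3) K) (v : Ln K) (T : Finset (Ln K))
    (hinj : Set.InjOn (tt v) T) (hT : ∀ w ∈ T, Meet v w ∧ res w F = 0) (hv : res v F = 0)
    (hgrad : ∃ i, res v (pderiv i F) ≠ 0)
    (hcard : F.totalDegree < T.card) (h0 : F ∣ RR0 F) (h1 : F ∣ RR1 F)
    (hd1 : 1 ≤ F.totalDegree) (hdp : F.totalDegree < p) :
    ∃ l n : K, T.card ≤ F.totalDegree +
      (T.filter (fun w => l * (w.β - v.β) + n * (v.s - w.s) = 1)).card := by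
  obtain ⟨hc, hP⟩ := local_ne F v T hinj hT hv hgrad hcard
  have hode := local_ode F v hv h0 h1 hc _ _ rfl rfl
  have dP := res_natDegree_le v _ (td_PP v.s F)
  have dc := res_natDegree_le v _ (totalDegree_pderiv 2 F)
  obtain ⟨w1, hw1, ht1⟩ : ∃ w ∈ T, (res v (PP v.s F)).eval (tt v w) ≠ 0 := by
    by_contra! hcon
    exact hP (poly_zero_of_many v T hinj _ dP hcon (by omega))
  obtain ⟨l, n, hln⟩ := ode (p := p) _ _ _ ht1 (by omega) (by omega) hode
  refine ⟨l, n, ?_⟩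
  have hsplit := Finset.card_filter_add_card_filter_not (s := T)
    (fun w => (res v (PP v.s F)).eval (tt v w) = 0)
  have hz : (T.filter (fun w => (res v (PP v.s F)).eval (tt v w) = 0)).card ≤ F.totalDegree := by
    apply card_zeros_le v _ (hinj.mono (Finset.coe_subset.mpr (Finset.filter_subset _ _))) _ hP (dP.trans (by omega))
    intro w hw
    exact (Finset.mem_filter.mp hw).2
  have hnz : (T.filter (fun w => ¬ (res v (PP v.s F)).eval (tt v w) = 0)).card ≤
      (T.filter (fun w => l * (w.β - v.β) + n * (v.s - w.s) = 1)).card := by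
    apply Finset.card_le_card
    intro w hw
    obtain ⟨hwT, hne⟩ := Finset.mem_filter.mp hw
    rw [Finset.mem_filter]
    refine ⟨hwT, ?_⟩
    have hm := (hT w hwT).1
    have h3 := meet_first hm F hv (hT w hwT).2
    rw [hln] at h3
    simp only [Polynomial.eval_mul, Polynomial.eval_add, Polynomial.eval_C, Polynomial.eval_X] at h3
    have h4 : (v.s - w.s) * tt v w = w.β - v.β := by
      rw [tt]; have := sub_ne_zero.mpr hm.1; field_simp
    apply mul_right_cancel₀ hne
    linear_combination -(l * (res v (PP v.s F)).eval (tt v w)) * h4 - h3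
  omega

end GKL


namespace GKL

open MvPolynomial

variable {K : Type*} [Field K]

open Classical in
/-- lines on which all polynomials of degree at most `d` vanishing on `X` vanish -/
noncomputable def cl (W : Finset (Ln K)) (d : ℕ) (X : Finset (Ln K)) : Finset (Ln K) :=
  W.filter (fun w => ∀ F : MvPolynomial (Fin 3) K, F.totalDegree ≤ d →
    (∀ x ∈ X, res x F = 0) → res w F = 0)

lemma cl_mono (W : Finset (Ln K)) (d : ℕ) {X Y : Finset (Ln K)} (h : X ⊆ Y) :
    cl W d X ⊆ cl W d Y := by
  intro w hw
  simp only [cl, Finset.mem_filter] at hw ⊢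
  exact ⟨hw.1, fun F hF hY => hw.2 F hF (fun x hx => hY x (h hx))⟩

lemma subset_cl (W : Finset (Ln K)) (d : ℕ) {X : Finset (Ln K)} (h : X ⊆ W) :
    X ⊆ cl W d X := by
  intro w hw
  simp only [cl, Finset.mem_filter]
  exact ⟨h hw, fun F hF hY => hY w hw⟩

lemma greedy [DecidableEq (Ln K)] (W : Finset (Ln K)) (N : Ln K → Finset (Ln K))
    (hN : ∀ v ∈ W, N v ⊆ W) (hsymm : ∀ v ∈ W, ∀ w ∈ N v, v ∈ N w)
    (hmeet : ∀ v ∈ W, ∀ w ∈ N v, Meet v w) (hinj : ∀ v ∈ W, Set.InjOn (tt v) (N v))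
    (D0 d : ℕ) (hdeg : ∀ v ∈ W, D0 ≤ (N v).card) (hd : d < D0) :
    ∃ X ⊆ W, cl W d X = W ∧ (D0 - d) * X.card ≤ W.card * (d + 1) := by
  let Φ : Finset (Ln K) → ℕ := fun X => ∑ w ∈ W, min ((N w ∩ cl W d X).card) (d + 1)
  have hΦ : ∀ X, Φ X ≤ W.card * (d + 1) := by
    intro X
    refine (Finset.sum_le_card_nsmul W _ (d + 1) (fun w _ => min_le_right _ _)).trans ?_
    simp
  let S := W.powerset.filter (fun X => (D0 - d) * X.card ≤ Φ X)
  have hS : S.Nonempty := ⟨∅, by simp [S]⟩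
  obtain ⟨X, hX, hmax⟩ := Finset.exists_max_image S Finset.card hS
  obtain ⟨hXW, hXΦ⟩ := Finset.mem_filter.mp hX
  rw [Finset.mem_powerset] at hXW
  refine ⟨X, hXW, ?_, hXΦ.trans (hΦ X)⟩
  by_contra hne
  have hsub : cl W d X ⊆ W := fun w hw => by
    simp only [cl, Finset.mem_filter] at hw; exact hw.1
  obtain ⟨v, hvW, hv⟩ : ∃ v ∈ W, v ∉ cl W d X := by
    by_contra! hcon
    exact hne (Finset.Subset.antisymm hsub hcon)
  have hfew : ∀ w ∈ W, w ∉ cl W d X → (N w ∩ cl W d X).card ≤ d := by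
    intro w hw hwc
    by_contra! hlt
    apply hwc
    simp only [cl, Finset.mem_filter]
    refine ⟨hw, fun F hF hFX => ?_⟩
    apply vanish_of_many w (N w ∩ cl W d X)
      ((hinj w hw).mono (Finset.coe_subset.mpr Finset.inter_subset_left))
      (fun u hu => hmeet w hw u (Finset.mem_inter.mp hu).1) F hF _ hlt
    intro u hu
    have := (Finset.mem_inter.mp hu).2
    simp only [cl, Finset.mem_filter] at this
    exact this.2 F hF hFX
  have hvX : v ∉ X := fun h => hv (subset_cl W d hXW h)
  have hX' : insert v X ⊆ W := Finset.insert_subset hvW hXW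
  have hstep : Φ X + (D0 - d) ≤ Φ (insert v X) := by
    have h1 : (D0 - d) ≤ (N v \ cl W d X).card := by
      have := Finset.card_sdiff_add_card_inter (N v) (cl W d X)
      have h2 := hfew v hvW hv
      have h3 := hdeg v hvW
      omega
    have h2 : (N v \ cl W d X).card = ∑ w ∈ W, if w ∈ N v \ cl W d X then 1 else 0 := by
      rw [Finset.sum_ite_mem, Finset.inter_eq_right.mpr, Finset.sum_const, smul_eq_mul, mul_one]
      exact Finset.sdiff_subset.trans (hN v hvW)
    refine (Nat.add_le_add_left (h1.trans h2.le) _).trans ?_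
    rw [← Finset.sum_add_distrib]
    apply Finset.sum_le_sum
    intro w hw
    have hmono : N w ∩ cl W d X ⊆ N w ∩ cl W d (insert v X) :=
      Finset.inter_subset_inter_left (cl_mono W d (Finset.subset_insert v X))
    have hcm := Finset.card_le_card hmono
    split_ifs with hwN
    · obtain ⟨hwN, hwc⟩ := Finset.mem_sdiff.mp hwN
      have h5 := hfew w hw hwc
      have h6 : (N w ∩ cl W d X).card < (N w ∩ cl W d (insert v X)).card := by
        apply Finset.card_lt_card
        refine ⟨hmono, fun hcon => hv ?_⟩
        have : v ∈ N w ∩ cl W d (insert v X) := by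
          rw [Finset.mem_inter]
          exact ⟨hsymm v hvW w hwN, subset_cl W d hX' (Finset.mem_insert_self v X)⟩
        exact (Finset.mem_inter.mp (hcon this)).2
      omega
    · omega
  have hmem : insert v X ∈ S := by
    simp only [S, Finset.mem_filter, Finset.mem_powerset]
    refine ⟨hX', ?_⟩
    rw [Finset.card_insert_of_notMem hvX, Nat.mul_add, mul_one]
    omega
  have := hmax _ hmem
  rw [Finset.card_insert_of_notMem hvX] at this
  omega

lemma degred [DecidableEq (Ln K)] (W : Finset (Ln K)) (N : Ln K → Finset (Ln K))
    (hN : ∀ v ∈ W, N v ⊆ W) (hsymm : ∀ v ∈ W, ∀ w ∈ N v, v ∈ N w)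
    (hmeet : ∀ v ∈ W, ∀ w ∈ N v, Meet v w) (hinj : ∀ v ∈ W, Set.InjOn (tt v) (N v))
    (D0 d : ℕ) (hdeg : ∀ v ∈ W, D0 ≤ (N v).card) (hd : d < D0)
    (hc : 6 * W.card ≤ (d + 2) * (D0 - d)) :
    ∃ F : MvPolynomial (Fin 3) K, F ≠ 0 ∧ F.totalDegree ≤ d ∧ ∀ w ∈ W, res w F = 0 := by
  obtain ⟨X, hXW, hcl, hX⟩ := greedy W N hN hsymm hmeet hinj D0 d hdeg hd
  obtain ⟨F, hF0, hFd, hFX⟩ := exists_vanishing X d (by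
    obtain ⟨m, hm⟩ : ∃ m, m = D0 - d := ⟨_, rfl⟩
    rw [← hm] at hX hc
    have hm0 : 0 < m := by omega
    have h1 : 6 * X.card ≤ (d + 2) * (d + 1) := by
      apply Nat.le_of_mul_le_mul_left _ hm0
      nlinarith
    have h2 := six_choose d
    have h3 : 6 * (X.card * (d + 1)) < 6 * (d + 3).choose 3 := by
      rw [h2]; nlinarith
    omega)
  refine ⟨F, hF0, hFd, fun w hw => ?_⟩
  rw [← hcl] at hw
  simp only [cl, Finset.mem_filter] at hw
  exact hw.2 F hFd hFX

open Classical in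
noncomputable def LF (W : Finset (Ln K)) (F : MvPolynomial (Fin 3) K) : Finset (Ln K) :=
  W.filter (fun w => res w F = 0)

lemma mem_LF {W : Finset (Ln K)} {F : MvPolynomial (Fin 3) K} {w : Ln K} :
    w ∈ LF W F ↔ w ∈ W ∧ res w F = 0 := by simp [LF]

lemma exists_irred (W : Finset (Ln K)) (d : ℕ) (G : MvPolynomial (Fin 3) K)
    (hG1 : 1 ≤ G.totalDegree) (hG : 8 * d * G.totalDegree ≤ (LF W G).card) :
    ∃ F : MvPolynomial (Fin 3) K, Irreducible F ∧ 1 ≤ F.totalDegree ∧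
      8 * d * F.totalDegree ≤ (LF W F).card := by
  classical
  have hex : ∃ n, ∃ F : MvPolynomial (Fin 3) K, F.totalDegree = n ∧ 1 ≤ n ∧
      8 * d * n ≤ (LF W F).card := ⟨_, G, rfl, hG1, hG⟩
  obtain ⟨F, hFn, hn1, hn⟩ := Nat.find_spec hex
  have hmin := fun m hm => Nat.find_min hex (m := m) hm
  rw [← hFn] at hn1 hn
  refine ⟨F, ?_, hn1, hn⟩
  have hF0 : F ≠ 0 := by rintro rfl; simp at hn1
  constructor
  · intro hu
    have := (isUnit_iff_totalDegree_of_isReduced.mp hu).2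
    omega
  · intro a b hab
    by_contra! hcon
    have ha0 : a ≠ 0 := by rintro rfl; simp at hab; exact hF0 hab
    have hb0 : b ≠ 0 := by rintro rfl; simp at hab; exact hF0 hab
    have hunit : ∀ a : MvPolynomial (Fin 3) K, a ≠ 0 → ¬ IsUnit a → 1 ≤ a.totalDegree := by
      intro a ha0 hau
      by_contra! hlt
      have h0 : a.totalDegree = 0 := by omega
      rw [totalDegree_eq_zero_iff_eq_C] at h0
      apply hau
      rw [h0]
      apply IsUnit.map
      rw [isUnit_iff_ne_zero]
      intro h
      rw [h, map_zero] at h0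
      exact ha0 h0
    have ha1 := hunit a ha0 hcon.1
    have hb1 := hunit b hb0 hcon.2
    have hdeg : F.totalDegree = a.totalDegree + b.totalDegree := by
      rw [hab, totalDegree_mul_of_isDomain ha0 hb0]
    have hsub : LF W F ⊆ LF W a ∪ LF W b := by
      intro w hw
      rw [Finset.mem_union, mem_LF, mem_LF]
      obtain ⟨h1, h2⟩ := mem_LF.mp hw
      rw [hab, map_mul, mul_eq_zero] at h2
      tauto
    have hcard := (Finset.card_le_card hsub).trans (Finset.card_union_le _ _)
    have h1 := hmin a.totalDegree (by omega)
    have h2 := hmin b.totalDegree (by omega)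
    push Not at h1 h2
    have h3 := h1 a rfl ha1
    have h4 := h2 b rfl hb1
    rw [hdeg] at hn
    nlinarith

theorem gk {p : ℕ} [CharP K p] [DecidableEq K] [DecidableEq (Ln K)] (W : Finset (Ln K))
    (hW : W.Nonempty)
    (N : Ln K → Finset (Ln K))
    (hN : ∀ v ∈ W, N v ⊆ W) (hsymm : ∀ v ∈ W, ∀ w ∈ N v, v ∈ N w)
    (hmeet : ∀ v ∈ W, ∀ w ∈ N v, Meet v w) (hinj : ∀ v ∈ W, Set.InjOn (tt v) (N v))
    (D0 d k : ℕ) (hdeg : ∀ v ∈ W, D0 ≤ (N v).card)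
    (hk : ∀ v ∈ W, ∀ l n : K,
      ((N v).filter (fun w => l * (w.β - v.β) + n * (v.s - w.s) = 1)).card ≤ k)
    (c2 : 6 * W.card ≤ (d + 2) * (D0 - d)) (c3 : 8 * d * d ≤ W.card) (c4 : 6 * d + k + 1 ≤ D0)
    (c5 : d < p) : False := by
  obtain ⟨G, hG0, hGd, hGW⟩ := degred W N hN hsymm hmeet hinj D0 d hdeg (by omega) c2
  have hG1 : 1 ≤ G.totalDegree := by
    by_contra! hlt
    have h0 : G.totalDegree = 0 := by omega
    rw [totalDegree_eq_zero_iff_eq_C] at h0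
    obtain ⟨w, hw⟩ := hW
    have h1 := hGW w hw
    rw [h0, res_C, Polynomial.C_eq_zero] at h1
    rw [h1, map_zero] at h0
    exact hG0 h0
  have hLG : LF W G = W := by
    ext w; rw [mem_LF]; exact ⟨fun h => h.1, fun h => ⟨h, hGW w h⟩⟩
  obtain ⟨F, hF, hF1, hFL⟩ := exists_irred W d G hG1 (by
    rw [hLG]; exact (Nat.mul_le_mul_left _ hGd).trans c3)
  obtain ⟨n, hn⟩ : ∃ n, n = F.totalDegree := ⟨_, rfl⟩
  rw [← hn] at hF1 hFL
  have hd1 : 1 ≤ d := hG1.trans hGd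
  have hdn : 1 ≤ d * n := Nat.mul_pos hd1 hF1
  have hFG : F ∣ G := by
    by_contra hnd
    have := bezout F G hF hnd (LF W F) (fun v hv => (mem_LF.mp hv).2)
      (fun v hv => hGW v (mem_LF.mp hv).1)
    rw [← hn] at this
    have h2 : n * G.totalDegree ≤ n * d := Nat.mul_le_mul_left _ hGd
    nlinarith
  have hnd : n ≤ d := by
    rw [hn]; exact (totalDegree_le_of_dvd_of_isDomain hFG hG0).trans hGd
  obtain ⟨H, hGH, hFH⟩ := (FiniteMultiplicity.of_not_isUnit hF.not_isUnit hG0).exists_eq_pow_mul_and_not_dvd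
  have hHd : H.totalDegree ≤ d :=
    (totalDegree_le_of_dvd_of_isDomain ⟨_, hGH.trans (mul_comm _ _)⟩ hG0).trans hGd
  have hor : ∀ w ∈ W, res w F = 0 ∨ res w H = 0 := by
    intro w hw
    have := hGW w hw
    rw [hGH, map_mul, map_pow] at this
    rcases mul_eq_zero.mp this with h | h
    · left; exact eq_zero_of_pow_eq_zero h
    · right; exact h
  obtain ⟨i0, hi0⟩ := exists_pderiv_ne (p := p) F (by omega) (by omega)
  have hFi : ¬ F ∣ pderiv i0 F := by
    intro h
    have h1 := totalDegree_le_of_dvd_of_isDomain h hi0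
    have h2 := totalDegree_pderiv i0 F
    omega
  let L2 := (LF W F).filter (fun v => res v H ≠ 0 ∧ res v (pderiv i0 F) ≠ 0)
  have b1 : ((LF W F).filter (fun v => res v H = 0)).card ≤ d * n := by
    have := bezout F H hF hFH ((LF W F).filter (fun v => res v H = 0))
      (fun v hv => (mem_LF.mp (Finset.mem_filter.mp hv).1).2) (fun v hv => (Finset.mem_filter.mp hv).2)
    rw [← hn] at this
    nlinarith
  have b2 : ((LF W F).filter (fun v => res v (pderiv i0 F) = 0)).card ≤ d * n := by
    have := bezout F _ hF hFi ((LF W F).filter (fun v => res v (pderiv i0 F) = 0))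
      (fun v hv => (mem_LF.mp (Finset.mem_filter.mp hv).1).2) (fun v hv => (Finset.mem_filter.mp hv).2)
    rw [← hn] at this
    have h2 := totalDegree_pderiv i0 F
    have h3 : (pderiv i0 F).totalDegree ≤ d := by omega
    nlinarith
  have hL2 : 6 * (d * n) ≤ L2.card := by
    have hsub : LF W F ⊆ L2 ∪ ((LF W F).filter (fun v => res v H = 0) ∪
        (LF W F).filter (fun v => res v (pderiv i0 F) = 0)) := by
      intro v hv
      simp only [L2, Finset.mem_union, Finset.mem_filter]
      tauto
    have h1 := Finset.card_le_card hsub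
    have h2 := Finset.card_union_le L2 ((LF W F).filter (fun v => res v H = 0) ∪
        (LF W F).filter (fun v => res v (pderiv i0 F) = 0))
    have h3 := Finset.card_union_le ((LF W F).filter (fun v => res v H = 0))
        ((LF W F).filter (fun v => res v (pderiv i0 F) = 0))
    have h4 : 8 * d * n = 8 * (d * n) := by ring
    omega
  -- neighbours in Z(F)
  let T : Ln K → Finset (Ln K) := fun v => (N v).filter (fun w => res w F = 0)
  have hTcard : ∀ v ∈ L2, D0 ≤ (T v).card + d := by
    intro v hv
    obtain ⟨hvL, hvH, hvi⟩ := Finset.mem_filter.mp hv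
    have hvW := (mem_LF.mp hvL).1
    have hsplit := Finset.card_filter_add_card_filter_not (s := N v) (fun w => res w F = 0)
    have hz : ((N v).filter (fun w => ¬ res w F = 0)).card ≤ d := by
      apply card_zeros_le v _
        ((hinj v hvW).mono (Finset.coe_subset.mpr (Finset.filter_subset _ _))) _ hvH
        (res_natDegree_le v H hHd)
      intro w hw
      obtain ⟨hwN, hwF⟩ := Finset.mem_filter.mp hw
      rw [(hmeet v hvW w hwN).eval_eq, (hor w (hN v hvW hwN)).resolve_left hwF]
      simp
    have := hdeg v hvW
    simp only [T]
    omega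
  have hTprop : ∀ v ∈ L2, Set.InjOn (tt v) (T v) ∧ (∀ w ∈ T v, Meet v w ∧ res w F = 0) ∧
      res v F = 0 := by
    intro v hv
    obtain ⟨hvL, hvH, hvi⟩ := Finset.mem_filter.mp hv
    obtain ⟨hvW, hvF⟩ := mem_LF.mp hvL
    refine ⟨(hinj v hvW).mono (Finset.coe_subset.mpr (Finset.filter_subset _ _)), ?_, hvF⟩
    intro w hw
    obtain ⟨hwN, hwF⟩ := Finset.mem_filter.mp hw
    exact ⟨hmeet v hvW w hwN, hwF⟩
  have hflat : ∀ v ∈ L2, res v (RR1 F) = 0 ∧ res v (RR0 F) = 0 := by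
    intro v hv
    obtain ⟨h1, h2, h3⟩ := hTprop v hv
    have := hTcard v hv
    exact local_flat F v (T v) h1 h2 h3 (by omega)
  have hdiv : ∀ R : MvPolynomial (Fin 3) K, R.totalDegree ≤ 4 * F.totalDegree →
      (∀ v ∈ L2, res v R = 0) → F ∣ R := by
    intro R hR hRL
    by_contra hnd'
    have := bezout F R hF hnd' L2 (fun v hv => (hTprop v hv).2.2) hRL
    rw [← hn] at this hR
    have h5 : n * R.totalDegree ≤ n * (4 * d) := Nat.mul_le_mul_left _ (by omega)
    nlinarith
  have hdiv1 := hdiv (RR1 F) (td_RR1 F) (fun v hv => (hflat v hv).1)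
  have hdiv0 := hdiv (RR0 F) (td_RR0 F) (fun v hv => (hflat v hv).2)
  obtain ⟨v, hv⟩ : L2.Nonempty := Finset.card_pos.mp (by omega)
  obtain ⟨h1, h2, h3⟩ := hTprop v hv
  have hTc := hTcard v hv
  obtain ⟨hvL, hvH, hvi⟩ := Finset.mem_filter.mp hv
  obtain ⟨l, m, hlm⟩ := local_final (p := p) F v (T v) h1 h2 h3 ⟨i0, hvi⟩ (by omega) hdiv0 hdiv1
    (by omega) (by omega)
  have h4 := hk v (mem_LF.mp hvL).1 l m
  have h5 : ((T v).filter (fun w => l * (w.β - v.β) + m * (v.s - w.s) = 1)).card ≤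
      ((N v).filter (fun w => l * (w.β - v.β) + m * (v.s - w.s) = 1)).card :=
    Finset.card_le_card (Finset.filter_subset_filter _ (Finset.filter_subset _ _))
  omega

end GKL


namespace GKL

lemma prune {α : Type*} [DecidableEq α] (V : Finset α) (Adj : α → α → Prop) [DecidableRel Adj]
    (hs : ∀ v w, Adj v w → Adj w v) (D0 : ℕ) (hD0 : 1 ≤ D0) (hV : V.Nonempty)
    (h : 2 * D0 * V.card ≤ ∑ v ∈ V, (V.filter (Adj v)).card) :
    ∃ W ⊆ V, W.Nonempty ∧ ∀ v ∈ W, D0 ≤ (W.filter (Adj v)).card := by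
  let S := V.powerset.filter (fun W => W.Nonempty ∧
    2 * D0 * W.card ≤ ∑ v ∈ W, (W.filter (Adj v)).card)
  have hS : S.Nonempty := ⟨V, by simp [S, hV, h]⟩
  obtain ⟨W, hWS, hmin⟩ := Finset.exists_min_image S Finset.card hS
  obtain ⟨hWV, hW, hWs⟩ := Finset.mem_filter.mp hWS
  rw [Finset.mem_powerset] at hWV
  refine ⟨W, hWV, hW, ?_⟩
  intro v hv
  by_contra! hlt
  have hcard : (W.erase v).card + 1 = W.card := Finset.card_erase_add_one hv
  have h1 : ∑ w ∈ W, (W.filter (Adj w)).card ≤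
      ∑ w ∈ W.erase v, ((W.erase v).filter (Adj w)).card + 2 * (W.filter (Adj v)).card := by
    rw [← Finset.add_sum_erase W _ hv]
    have h2 : ∀ w ∈ W.erase v, (W.filter (Adj w)).card ≤
        ((W.erase v).filter (Adj w)).card + if Adj w v then 1 else 0 := by
      intro w hw
      rw [← Finset.insert_erase hv, Finset.filter_insert]
      split_ifs with hwv
      · refine (Finset.card_insert_le _ _).trans ?_
        simp
      · simp
    have h3 := Finset.sum_le_sum h2
    rw [Finset.sum_add_distrib, ← Finset.card_filter] at h3
    have h4 : ((W.erase v).filter (fun w => Adj w v)).card ≤ (W.filter (Adj v)).card := by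
      apply Finset.card_le_card
      intro w hw
      obtain ⟨hw1, hw2⟩ := Finset.mem_filter.mp hw
      exact Finset.mem_filter.mpr ⟨Finset.mem_of_mem_erase hw1, hs _ _ hw2⟩
    omega
  have h2 : 2 * D0 * (W.erase v).card + 2 ≤
      ∑ w ∈ W.erase v, ((W.erase v).filter (Adj w)).card := by
    rw [← hcard, Nat.mul_add] at hWs
    omega
  have hne : (W.erase v).Nonempty := by
    by_contra hemp
    rw [Finset.not_nonempty_iff_eq_empty] at hemp
    rw [hemp] at h2
    simp at h2
  have := hmin (W.erase v) (by
    simp only [S, Finset.mem_filter, Finset.mem_powerset]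
    exact ⟨(Finset.erase_subset _ _).trans hWV, hne, by omega⟩)
  omega

lemma nums (n D0 k W d p : ℕ) (hn : 1 ≤ n) (hD : 2304 * n ≤ D0 ^ 2) (hW : W ≤ 2 * n)
    (hp : n ≤ p ^ 2) (hk : k ^ 2 ≤ n) (hd : d = 12 * W / D0) :
    6 * W ≤ (d + 2) * (D0 - d) ∧ 8 * d * d ≤ W ∧ 6 * d + k + 1 ≤ D0 ∧ d < p := by
  have hD48 : 48 ≤ D0 := by nlinarith
  have h1 : D0 * d ≤ 12 * W := by rw [hd]; exact Nat.mul_div_le _ _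
  have h2 : 12 * W < D0 * (d + 1) := by
    rw [hd]; exact Nat.lt_mul_div_succ _ (by omega)
  have h3 : D0 * d ≤ 24 * n := by omega
  have h4 : 4 * d ^ 2 ≤ n := by
    have h5 : (D0 * d) ^ 2 ≤ (24 * n) ^ 2 := Nat.pow_le_pow_left h3 2
    have h6 : 2304 * n * d ^ 2 ≤ D0 ^ 2 * d ^ 2 := Nat.mul_le_mul_right _ hD
    have h7 : n * (4 * d ^ 2) ≤ n * n := by nlinarith
    exact Nat.le_of_mul_le_mul_left h7 hn
  have h5 : 96 * d ≤ D0 := by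
    have : (96 * d) ^ 2 ≤ D0 ^ 2 := by nlinarith
    exact (Nat.pow_le_pow_iff_left (by norm_num)).mp this
  have h6 : 48 * k ≤ D0 := by
    have : (48 * k) ^ 2 ≤ D0 ^ 2 := by nlinarith
    exact (Nat.pow_le_pow_iff_left (by norm_num)).mp this
  refine ⟨?_, ?_, by omega, ?_⟩
  · obtain ⟨m, hm⟩ : ∃ m, D0 = m + d := ⟨D0 - d, by omega⟩
    rw [hm, Nat.add_sub_cancel]
    rw [hm] at h2 h5
    nlinarith
  · nlinarith
  · have : d ^ 2 < p ^ 2 := by nlinarith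
    exact lt_of_pow_lt_pow_left₀ 2 (Nat.zero_le _) this

open Classical in
theorem gk2 {K : Type*} [Field K] {p : ℕ} [CharP K p] (V : Finset (Ln K)) (hV : V.Nonempty)
    (Adj : Ln K → Ln K → Prop) (hs : ∀ v w, Adj v w → Adj w v)
    (hmeet : ∀ v ∈ V, ∀ w ∈ V, Adj v w → Meet v w)
    (hinj : ∀ v ∈ V, Set.InjOn (tt v) (V.filter (Adj v)))
    (n D0 k : ℕ) (hk : ∀ v ∈ V, ∀ l m : K, ((V.filter (Adj v)).filter
      (fun w => l * (w.β - v.β) + m * (v.s - w.s) = 1)).card ≤ k)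
    (hn : 1 ≤ n) (hD : 2304 * n ≤ D0 ^ 2) (hVn : V.card ≤ 2 * n)
    (hp : n ≤ p ^ 2) (hkn : k ^ 2 ≤ n)
    (h : 2 * D0 * V.card ≤ ∑ v ∈ V, (V.filter (Adj v)).card) : False := by
  have hD1 : 1 ≤ D0 := by
    by_contra! hlt
    have : D0 = 0 := by omega
    rw [this] at hD; omega
  obtain ⟨W, hWV, hW, hWd⟩ := prune V Adj hs D0 hD1 hV h
  obtain ⟨e1, e2, e3, e4⟩ := nums n D0 k W.card (12 * W.card / D0) p hn hD
    ((Finset.card_le_card hWV).trans hVn) hp hkn rfl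
  refine gk (p := p) W hW (fun v => W.filter (Adj v)) (fun v _ => Finset.filter_subset _ _) ?_ ?_ ?_
    D0 _ k hWd ?_ e1 e2 e3 e4
  · intro v hv w hw
    exact Finset.mem_filter.mpr ⟨hv, hs _ _ (Finset.mem_filter.mp hw).2⟩
  · intro v hv w hw
    exact hmeet v (hWV hv) w (hWV (Finset.mem_filter.mp hw).1) (Finset.mem_filter.mp hw).2
  · intro v hv
    exact (hinj v (hWV hv)).mono (Finset.coe_subset.mpr (Finset.filter_subset_filter _ hWV))
  · intro v hv l m
    refine le_trans (Finset.card_le_card ?_) (hk v (hWV hv) l m)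
    exact Finset.filter_subset_filter _ (Finset.filter_subset_filter _ hWV)

end GKL

namespace GKL

theorem cauchy_energy {α β : Type*} [DecidableEq α] [DecidableEq β] (T : Finset α) (f : α → β) :
    T.card ^ 2 ≤ (T.image f).card * ((T ×ˢ T).filter (fun q => f q.1 = f q.2)).card := by
  have h1 := Finset.card_eq_sum_card_image f T
  have h2 : ((T ×ˢ T).filter (fun q => f q.1 = f q.2)).card
      = ∑ b ∈ T.image f, ((T.filter (fun a => f a = b)).card) ^ 2 := by
    rw [Finset.card_eq_sum_card_fiberwise (f := fun q => f q.1) (t := T.image f)]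
    · apply Finset.sum_congr rfl
      intro b hb
      rw [sq, ← Finset.card_product]
      congr 1
      ext ⟨x, y⟩
      simp only [mem_filter, mem_product]
      constructor
      · rintro ⟨⟨⟨hx, hy⟩, hxy⟩, hb⟩
        exact ⟨⟨hx, hb⟩, hy, hxy ▸ hb⟩
      · rintro ⟨⟨hx, hb⟩, hy, hc⟩
        exact ⟨⟨⟨hx, hy⟩, hb.trans hc.symm⟩, hb⟩
    · intro q hq
      simp only [coe_filter, mem_product, Set.mem_ofPred_eq] at hq
      exact mem_coe.2 (mem_image_of_mem f hq.1.1)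
  rw [h2, h1]
  exact sq_sum_le_card_mul_sum_sq

section
variable {F K : Type*} [Field F] [Field K] [Algebra F K]

/-- The first family of lines. -/
noncomputable def LL (θ : K) (x : F × F × F) : Ln K :=
  ⟨algebraMap F K x.1, θ * algebraMap F K x.2.2, algebraMap F K (x.1 * x.2.1)⟩

/-- The second family of lines. -/
noncomputable def MM (θ : K) (x : F × F × F) : Ln K :=
  ⟨algebraMap F K x.1 / θ, algebraMap F K x.2.2, algebraMap F K (x.1 * x.2.1)⟩

variable {θ : K} (hθ : ∀ x : F, algebraMap F K x ≠ θ)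
include hθ

theorem th0 : θ ≠ 0 := by
  have := hθ 0
  rw [map_zero] at this
  exact this.symm

theorem th_ind {u v : F} (h : algebraMap F K u = θ * algebraMap F K v) : u = 0 ∧ v = 0 := by
  by_cases hv : v = 0
  · subst hv
    simp at h
    exact ⟨h, rfl⟩
  · exfalso
    apply hθ (u / v)
    have hv' : algebraMap F K v ≠ 0 := by simpa using hv
    rw [map_div₀, h]
    field_simp

theorem LL_inj {x y : F × F × F} (hx : x.1 ≠ 0) (h : LL θ x = LL θ y) : x = y := by
  obtain ⟨a, b, c⟩ := x
  obtain ⟨a', b', c'⟩ := y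
  have h0 := th0 hθ
  simp only [LL, Ln.mk.injEq] at h
  obtain ⟨h1, h2, h3⟩ := h
  have e1 : a = a' := (algebraMap F K).injective h1
  have e2 : c = c' := (algebraMap F K).injective (mul_left_cancel₀ h0 h2)
  have e3 := (algebraMap F K).injective h3
  subst e1
  simp only at hx e3
  have := mul_left_cancel₀ hx e3
  subst e2 this
  rfl

theorem MM_inj {x y : F × F × F} (hx : x.1 ≠ 0) (h : MM θ x = MM θ y) : x = y := by
  obtain ⟨a, b, c⟩ := x
  obtain ⟨a', b', c'⟩ := y
  have h0 := th0 hθ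
  simp only [MM, Ln.mk.injEq] at h
  obtain ⟨h1, h2, h3⟩ := h
  have e1 : a = a' := (algebraMap F K).injective (by field_simp at h1; exact h1)
  have e2 : c = c' := (algebraMap F K).injective h2
  have e3 := (algebraMap F K).injective h3
  subst e1
  simp only at hx e3
  have := mul_left_cancel₀ hx e3
  subst e2 this
  rfl

theorem LM_s {x y : F × F × F} (hx : x.1 ≠ 0) : (LL θ x).s ≠ (MM θ y).s := by
  intro h
  simp only [LL, MM] at h
  have h0 := th0 hθ
  have : algebraMap F K y.1 = θ * algebraMap F K x.1 := by
    rw [h]; field_simp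
  exact hx (th_ind hθ this).2

theorem LM_meet {x y : F × F × F} (hx : x.1 ≠ 0) :
    Meet (LL θ x) (MM θ y) ↔ x.1 * (x.2.1 + y.2.2) = y.1 * (y.2.1 + x.2.2) := by
  have h0 := th0 hθ
  have hs := LM_s hθ (y := y) hx
  unfold Meet
  constructor
  · rintro ⟨-, h⟩
    simp only [LL, MM] at h
    apply (algebraMap F K).injective
    have : algebraMap F K y.1 / θ * (θ * algebraMap F K x.2.2)
        = algebraMap F K y.1 * algebraMap F K x.2.2 := by field_simp
    rw [this] at h
    simp only [map_mul, map_add] at h ⊢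
    linear_combination h
  · intro h
    refine ⟨hs, ?_⟩
    simp only [LL, MM]
    have h' := congrArg (algebraMap F K) h
    have : algebraMap F K y.1 / θ * (θ * algebraMap F K x.2.2)
        = algebraMap F K y.1 * algebraMap F K x.2.2 := by field_simp
    rw [this]
    simp only [map_mul, map_add] at h' ⊢
    linear_combination h'

omit hθ in
theorem Meet.symm' {v w : Ln K} (h : Meet v w) : Meet w v :=
  ⟨h.1.symm, by linear_combination -h.2⟩

omit hθ in
/-- common point equations -/
theorem Meet.eqs {v w : Ln K} (h : Meet v w) :
    v.s * tt v w + v.β = w.s * tt v w + w.β ∧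
    v.s * (v.s * tt v w + v.β) + v.e = w.s * (w.s * tt v w + w.β) + w.e := by
  have hd : v.s - w.s ≠ 0 := sub_ne_zero.2 h.1
  have ht : tt v w * (v.s - w.s) = w.β - v.β := by unfold tt; field_simp
  have h2 := h.2
  refine ⟨by linear_combination ht, ?_⟩
  linear_combination (v.s + w.s) * ht + h2

/-- injectivity in the first case -/
theorem inj_LM {x y z : F × F × F} (hx : x.1 ≠ 0) (hy : y.1 ≠ 0)
    (m1 : Meet (LL θ x) (MM θ y)) (m2 : Meet (LL θ x) (MM θ z))
    (e1 : (LL θ x).e ≠ (MM θ y).e)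
    (ht : tt (LL θ x) (MM θ y) = tt (LL θ x) (MM θ z)) : y = z := by
  have h0 := th0 hθ
  obtain ⟨p1, p2⟩ := m1.eqs
  obtain ⟨q1, q2⟩ := m2.eqs
  rw [← ht] at q1 q2
  set t := tt (LL θ x) (MM θ y)
  by_cases hs : y.1 = z.1
  · apply MM_inj hθ hy
    have hs' : (MM θ y).s = (MM θ z).s := by simp [MM, hs]
    have hb : (MM θ y).β = (MM θ z).β := by
      rw [← hs'] at q1; linear_combination q1 - p1
    have he : (MM θ y).e = (MM θ z).e := by
      rw [← hs', ← hb] at q2; linear_combination q2 - p2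
    generalize MM θ y = u at *
    generalize MM θ z = v at *
    obtain ⟨_, _, _⟩ := u
    obtain ⟨_, _, _⟩ := v
    simp_all
  · exfalso
    set Y := (LL θ x).s * t + (LL θ x).β with hY
    rw [← p1] at p2
    rw [← q1] at q2
    simp only [LL, MM] at p2 q2 e1
    have hd : y.1 - z.1 ≠ 0 := sub_ne_zero.2 hs
    have hd' : algebraMap F K y.1 - algebraMap F K z.1 ≠ 0 := by
      rw [← map_sub]; exact fun h => hd ((map_eq_zero _).1 h)
    set f : F := (z.1 * z.2.1 - y.1 * y.2.1) / (y.1 - z.1) with hf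
    have hYf : Y = θ * algebraMap F K f := by
      rw [hf, map_div₀, map_sub, map_sub]
      field_simp
      have := p2.symm.trans q2
      field_simp at this
      linear_combination this
    rw [hYf] at p2
    have key : algebraMap F K (x.1 * x.2.1 - y.1 * y.2.1 - y.1 * f)
        = θ * algebraMap F K (- x.1 * f) := by
      have : algebraMap F K y.1 / θ * (θ * algebraMap F K f)
        = algebraMap F K y.1 * algebraMap F K f := by field_simp
      rw [this] at p2
      simp only [map_mul, map_sub, map_neg] at p2 ⊢
      linear_combination p2
    obtain ⟨k1, k2⟩ := th_ind hθ key
    have f0 : f = 0 := by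
      rcases mul_eq_zero.1 k2 with h | h
      · exact absurd (neg_eq_zero.1 h) hx
      · exact h
    apply e1
    rw [f0] at k1
    congr 1
    linear_combination k1

theorem inj_ML {x y z : F × F × F} (hy : y.1 ≠ 0) (hx : x.1 ≠ 0)
    (m1 : Meet (MM θ x) (LL θ y)) (m2 : Meet (MM θ x) (LL θ z))
    (e1 : (MM θ x).e ≠ (LL θ y).e)
    (ht : tt (MM θ x) (LL θ y) = tt (MM θ x) (LL θ z)) : y = z := by
  have h0 := th0 hθ
  obtain ⟨p1, p2⟩ := m1.eqs
  obtain ⟨q1, q2⟩ := m2.eqs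
  rw [← ht] at q1 q2
  set t := tt (MM θ x) (LL θ y)
  by_cases hs : y.1 = z.1
  · apply LL_inj hθ hy
    have hs' : (LL θ y).s = (LL θ z).s := by simp [LL, hs]
    have hb : (LL θ y).β = (LL θ z).β := by
      rw [← hs'] at q1; linear_combination q1 - p1
    have he : (LL θ y).e = (LL θ z).e := by
      rw [← hs', ← hb] at q2; linear_combination q2 - p2
    generalize LL θ y = u at *
    generalize LL θ z = v at *
    obtain ⟨_, _, _⟩ := u
    obtain ⟨_, _, _⟩ := v
    simp_all
  · exfalso
    set Y := (MM θ x).s * t + (MM θ x).β with hY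
    rw [← p1] at p2
    rw [← q1] at q2
    simp only [LL, MM] at p2 q2 e1
    have hd : y.1 - z.1 ≠ 0 := sub_ne_zero.2 hs
    have hd' : algebraMap F K y.1 - algebraMap F K z.1 ≠ 0 := by
      rw [← map_sub]; exact fun h => hd ((map_eq_zero _).1 h)
    set f : F := (z.1 * z.2.1 - y.1 * y.2.1) / (y.1 - z.1) with hf
    have hYf : Y = algebraMap F K f := by
      rw [hf, map_div₀, map_sub, map_sub]
      field_simp
      have := p2.symm.trans q2
      linear_combination this
    rw [hYf] at p2
    have key : algebraMap F K (x.1 * f)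
        = θ * algebraMap F K (y.1 * f + y.1 * y.2.1 - x.1 * x.2.1) := by
      field_simp at p2
      simp only [map_mul, map_sub, map_add] at p2 ⊢
      linear_combination p2
    obtain ⟨k1, k2⟩ := th_ind hθ key
    have f0 : f = 0 := by
      rcases mul_eq_zero.1 k1 with h | h
      · exact absurd h hx
      · exact h
    apply e1
    rw [f0] at k2
    congr 1
    linear_combination -k2

end
end GKL

namespace GKL

open Classical in
theorem thmR {F K : Type*} [Field F] [Field K] [Algebra F K] {p : ℕ} [CharP K p]
    {θ : K} (hθ : ∀ x : F, algebraMap F K x ≠ θ)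
    (A B C : Finset F) (hA : A.Nonempty) (hB : B.Nonempty) (hC : C.Nonempty) (h0 : 0 ∉ A)
    (n : ℕ) (hn : n = A.card * (B.card * C.card)) (hAn : A.card ^ 2 ≤ n) (hCn : C.card ^ 2 ≤ n)
    (hp : n ≤ p ^ 2) :
    n ≤ 40000 * ((A ×ˢ (B ×ˢ C)).image (fun x => x.1 * (x.2.1 + x.2.2))).card ^ 2 := by
  set T := A ×ˢ (B ×ˢ C) with hT
  set f : F × F × F → F := fun x => x.1 * (x.2.1 + x.2.2) with hf
  by_contra hcon
  push Not at hcon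
  have hTn : T.card = n := by rw [hT, card_product, card_product, hn]
  have hTne : T.Nonempty := hA.product (hB.product hC)
  have hT1 : ∀ x ∈ T, x.1 ≠ 0 := by
    intro x hx h
    rw [hT, mem_product] at hx
    exact h0 (h ▸ hx.1)
  have hn1 : 1 ≤ n := by rw [← hTn]; exact hTne.card_pos
  -- energy
  have hE := cauchy_energy T f
  set E := ((T ×ˢ T).filter (fun q => f q.1 = f q.2)).card with hEdef
  set Qc := (T.image f).card with hQc
  have hQ1 : 1 ≤ Qc := (hTne.image f).card_pos
  -- lines
  set V1 := T.image (LL θ) with hV1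
  set V2 := T.image (MM θ) with hV2
  set V := V1 ∪ V2 with hV
  set Adj : Ln K → Ln K → Prop := fun v w =>
    Meet v w ∧ v.e ≠ w.e ∧ ((v ∈ V1 ∧ w ∈ V2) ∨ (v ∈ V2 ∧ w ∈ V1)) with hAdj
  have hdis : ∀ v, v ∈ V1 → v ∈ V2 → False := by
    intro v h1 h2
    obtain ⟨x, hx, rfl⟩ := mem_image.1 h1
    obtain ⟨y, hy, hxy⟩ := mem_image.1 h2
    exact LM_s hθ (x := x) (y := y) (hT1 x hx) (by rw [hxy])
  have hVcard : V.card ≤ 2 * n := by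
    calc V.card ≤ V1.card + V2.card := card_union_le _ _
      _ ≤ T.card + T.card := add_le_add card_image_le card_image_le
      _ = 2 * n := by rw [hTn]; ring
  -- good pairs
  set R := (T ×ˢ T).filter (fun q => q.1.1 * (q.1.2.1 + q.2.2.2) = q.2.1 * (q.2.2.1 + q.1.2.2))
    with hR
  have hER : E ≤ R.card := by
    apply card_le_card_of_injOn
      (fun q => ((q.1.1, q.1.2.1, q.2.2.2), (q.2.1, q.2.2.1, q.1.2.2)))
    · rintro ⟨⟨a, b, c⟩, ⟨a', b', c'⟩⟩ hq
      simp only [hT, hf, hR, coe_filter, mem_filter, mem_product, Set.mem_ofPred_eq, mem_coe] at hq ⊢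
      tauto
    · rintro ⟨⟨a, b, c⟩, ⟨a', b', c'⟩⟩ _ ⟨⟨a1, b1, c1⟩, ⟨a1', b1', c1'⟩⟩ _ h
      simp only [Prod.mk.injEq] at h ⊢
      tauto
  set G := R.filter (fun q => q.1.1 * q.1.2.1 ≠ q.2.1 * q.2.2.1) with hG
  set Bd := R.filter (fun q => ¬ (q.1.1 * q.1.2.1 ≠ q.2.1 * q.2.2.1)) with hBd
  have hRG : G.card + Bd.card = R.card := card_filter_add_card_filter_not _
  have hBdc : Bd.card ≤ n * A.card := by
    rw [← hTn, ← card_product]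
    apply card_le_card_of_injOn (fun q => (q.1, q.2.1))
    · rintro ⟨⟨a, b, c⟩, ⟨a', b', c'⟩⟩ hq
      simp only [hT, hBd, hR, coe_filter, mem_filter, mem_product, Set.mem_ofPred_eq, mem_coe, coe_product] at hq ⊢
      simp only [Set.mem_prod, mem_coe]
      tauto
    · rintro ⟨⟨a, b, c⟩, ⟨a', b', c'⟩⟩ hq ⟨⟨a1, b1, c1⟩, ⟨a1', b1', c1'⟩⟩ hq1 h
      simp only [hBd, hR, coe_filter, mem_filter, mem_product, Set.mem_ofPred_eq] at hq hq1
      simp only [Prod.mk.injEq] at h ⊢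
      obtain ⟨⟨rfl, rfl, rfl⟩, rfl⟩ := h
      have z1 := hT1 _ hq.1.1.1
      have z2 := hT1 _ hq.1.1.2
      simp only [ne_eq, not_not] at z1 z2 hq hq1
      have i1 : b' = b1' := mul_left_cancel₀ z2 (hq.2.symm.trans hq1.2)
      subst i1
      have i2 : c' = c1' := by
        apply mul_left_cancel₀ z1
        linear_combination hq.1.2 - hq1.1.2
      simp [i2]
  have hmem : ∀ q ∈ G, q.1 ∈ T ∧ q.2 ∈ T ∧ Meet (LL θ q.1) (MM θ q.2) ∧
      (LL θ q.1).e ≠ (MM θ q.2).e := by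
    intro q hq
    simp only [hG, hR, mem_filter, mem_product] at hq
    refine ⟨hq.1.1.1, hq.1.1.2, (LM_meet hθ (hT1 _ hq.1.1.1)).2 hq.1.2, ?_⟩
    intro h
    exact hq.2 ((algebraMap F K).injective h)
  have hS : 2 * G.card ≤ ∑ v ∈ V, (V.filter (Adj v)).card := by
    have h1 : (∑ v ∈ V, (V.filter (Adj v)).card)
        = ((V ×ˢ V).filter (fun q => Adj q.1 q.2)).card := by
      rw [card_filter, sum_product]
      simp only [card_filter]
    rw [h1]
    set G1 := G.image (fun q => (LL θ q.1, MM θ q.2)) with hG1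
    set G2 := G.image (fun q => (MM θ q.2, LL θ q.1)) with hG2
    have c1 : G1.card = G.card := by
      apply card_image_of_injOn
      intro q hq q' hq' h
      simp only [Prod.mk.injEq] at h
      exact Prod.ext (LL_inj hθ (hT1 _ (hmem q hq).1) h.1) (MM_inj hθ (hT1 _ (hmem q hq).2.1) h.2)
    have c2 : G2.card = G.card := by
      apply card_image_of_injOn
      intro q hq q' hq' h
      simp only [Prod.mk.injEq] at h
      exact Prod.ext (LL_inj hθ (hT1 _ (hmem q hq).1) h.2) (MM_inj hθ (hT1 _ (hmem q hq).2.1) h.1)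
    have hd : Disjoint G1 G2 := by
      rw [Finset.disjoint_left]
      intro u hu hu'
      obtain ⟨q, hq, rfl⟩ := mem_image.1 hu
      obtain ⟨q', hq', h⟩ := mem_image.1 hu'
      simp only [Prod.mk.injEq] at h
      refine hdis (LL θ q.1) (mem_image_of_mem _ (hmem q hq).1) ?_
      rw [← h.1]
      exact mem_image_of_mem _ (hmem q' hq').2.1
    have : 2 * G.card = (G1 ∪ G2).card := by
      rw [card_union_of_disjoint hd, c1, c2]; ring
    rw [this]
    apply card_le_card
    intro u hu
    rw [mem_filter, mem_product]
    rcases mem_union.1 hu with h | h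
    · obtain ⟨q, hq, rfl⟩ := mem_image.1 h
      obtain ⟨t1, t2, m, e⟩ := hmem q hq
      have i1 : LL θ q.1 ∈ V1 := mem_image_of_mem _ t1
      have i2 : MM θ q.2 ∈ V2 := mem_image_of_mem _ t2
      exact ⟨⟨mem_union_left _ i1, mem_union_right _ i2⟩, m, e, Or.inl ⟨i1, i2⟩⟩
    · obtain ⟨q, hq, rfl⟩ := mem_image.1 h
      obtain ⟨t1, t2, m, e⟩ := hmem q hq
      have i1 : LL θ q.1 ∈ V1 := mem_image_of_mem _ t1
      have i2 : MM θ q.2 ∈ V2 := mem_image_of_mem _ t2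
      exact ⟨⟨mem_union_right _ i2, mem_union_left _ i1⟩, m.symm', e.symm, Or.inr ⟨i2, i1⟩⟩
  -- numbers
  set s := Nat.sqrt n with hs
  have hs1 : s * s ≤ n := Nat.sqrt_le n
  have hs2 : n < (s + 1) * (s + 1) := Nat.lt_succ_sqrt n
  have hs0 : 1 ≤ s := by
    by_contra h
    have : s = 0 := by omega
    rw [this] at hs2
    omega
  have hAs : A.card ≤ s := Nat.le_sqrt.2 (by rw [← sq]; exact hAn)
  have hQs : 200 * Qc ≤ s := Nat.le_sqrt.2 (by nlinarith)
  refine gk2 V ?_ Adj ?_ ?_ ?_ n (48 * (s + 1)) (max A.card C.card) ?_ hn1 (by nlinarith) hVcard hp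
    ?_ ?_ (p := p)
  · exact (hTne.image _).mono subset_union_left
  · rintro v w ⟨m, e, h⟩
    exact ⟨m.symm', e.symm, by tauto⟩
  · intro v _ w _ h
    exact h.1
  · intro v _ w hw w' hw' ht
    simp only [coe_filter, Set.mem_ofPred_eq] at hw hw'
    obtain ⟨-, m, e, h⟩ := hw
    obtain ⟨-, m', e', h'⟩ := hw'
    rcases h with ⟨h1, h2⟩ | ⟨h1, h2⟩
    · rcases h' with ⟨h1', h2'⟩ | ⟨h1', h2'⟩
      · obtain ⟨x, hx, rfl⟩ := mem_image.1 h1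
        obtain ⟨y, hy, rfl⟩ := mem_image.1 h2
        obtain ⟨z, hz, rfl⟩ := mem_image.1 h2'
        rw [inj_LM hθ (hT1 x hx) (hT1 y hy) m m' e ht]
      · exact (hdis _ h1 h1').elim
    · rcases h' with ⟨h1', h2'⟩ | ⟨h1', h2'⟩
      · exact (hdis _ h1' h1).elim
      · obtain ⟨x, hx, rfl⟩ := mem_image.1 h1
        obtain ⟨y, hy, rfl⟩ := mem_image.1 h2
        obtain ⟨z, hz, rfl⟩ := mem_image.1 h2'
        rw [inj_ML hθ (hT1 y hy) (hT1 x hx) m m' e ht]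
  · intro v hv l m
    -- neighbours of v lie in one family
    have hdet : ∀ w w' : Ln K, Adj v w → Adj v w' → w.s = w'.s → w.β = w'.β → w = w' := by
      intro w w' h h' h1 h2
      have h3 := h.1.2
      have h4 := h'.1.2
      obtain ⟨_, _, _⟩ := w
      obtain ⟨_, _, _⟩ := w'
      simp only at h1 h2 h3 h4
      subst h1 h2
      rw [Ln.mk.injEq]
      exact ⟨rfl, rfl, by linear_combination h4 - h3⟩
    have hfam : ∃ SA SB : Finset K, SA.card ≤ A.card ∧ SB.card ≤ C.card ∧
        ∀ w, Adj v w → w.s ∈ SA ∧ w.β ∈ SB := by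
      rcases mem_union.1 hv with h1 | h1
      · refine ⟨A.image (fun a => algebraMap F K a / θ), C.image (fun c => algebraMap F K c),
          card_image_le, card_image_le, ?_⟩
        rintro w ⟨-, -, h⟩
        rcases h with ⟨_, h2⟩ | ⟨h2, _⟩
        · obtain ⟨x, hx, rfl⟩ := mem_image.1 h2
          rw [hT, mem_product, mem_product] at hx
          exact ⟨mem_image_of_mem _ hx.1, mem_image_of_mem _ hx.2.2⟩
        · exact (hdis _ h1 h2).elim
      · refine ⟨A.image (fun a => algebraMap F K a), C.image (fun c => θ * algebraMap F K c),
          card_image_le, card_image_le, ?_⟩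
        rintro w ⟨-, -, h⟩
        rcases h with ⟨h2, _⟩ | ⟨_, h2⟩
        · exact (hdis _ h2 h1).elim
        · obtain ⟨x, hx, rfl⟩ := mem_image.1 h2
          rw [hT, mem_product, mem_product] at hx
          exact ⟨mem_image_of_mem _ hx.1, mem_image_of_mem (fun c => θ * algebraMap F K c) hx.2.2⟩
    obtain ⟨SA, SB, cA, cB, hfam⟩ := hfam
    by_cases hl : l = 0
    · refine le_trans ?_ (le_trans cB (le_max_right _ _))
      apply card_le_card_of_injOn (fun w => w.β)
      · intro w hw
        simp only [coe_filter, mem_filter, Set.mem_ofPred_eq] at hw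
        exact mem_coe.2 (hfam w hw.1.2).2
      · intro w hw w' hw' h
        simp only [coe_filter, mem_filter, Set.mem_ofPred_eq] at hw hw'
        have hm : m ≠ 0 := by
          rintro rfl
          have := hw.2
          rw [hl] at this
          simp at this
        refine hdet w w' hw.1.2 hw'.1.2 ?_ h
        apply mul_left_cancel₀ hm
        have e1 := hw.2
        have e2 := hw'.2
        rw [hl] at e1 e2
        linear_combination e2 - e1
    · refine le_trans ?_ (le_trans cA (le_max_left _ _))
      apply card_le_card_of_injOn (fun w => w.s)
      · intro w hw
        simp only [coe_filter, mem_filter, Set.mem_ofPred_eq] at hw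
        exact mem_coe.2 (hfam w hw.1.2).1
      · intro w hw w' hw' h
        simp only [coe_filter, mem_filter, Set.mem_ofPred_eq] at hw hw'
        refine hdet w w' hw.1.2 hw'.1.2 h ?_
        apply mul_left_cancel₀ hl
        have e1 := hw.2
        have e2 := hw'.2
        simp only at h
        rw [h] at e1
        linear_combination e1 - e2
  · rcases max_choice A.card C.card with h | h <;> rw [h] <;> assumption
  · refine le_trans ?_ (hS.trans (le_of_eq (by congr!)))
    have k1 : n * n ≤ Qc * E := by rw [← sq, ← hTn]; exact hE
    have k2 : n * (2 * (48 * (s + 1)) + A.card) ≤ E := by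
      have k3 : Qc * (2 * (48 * (s + 1)) + A.card) ≤ n := by
        calc Qc * (2 * (48 * (s + 1)) + A.card) ≤ Qc * (200 * s) :=
              Nat.mul_le_mul_left _ (by omega)
          _ = (200 * Qc) * s := by ring
          _ ≤ s * s := Nat.mul_le_mul_right _ hQs
          _ ≤ n := hs1
      have k4 : Qc * (n * (2 * (48 * (s + 1)) + A.card)) ≤ Qc * E := by
        calc _ = n * (Qc * (2 * (48 * (s + 1)) + A.card)) := by ring
          _ ≤ n * n := Nat.mul_le_mul_left _ k3
          _ ≤ _ := k1
      exact Nat.le_of_mul_le_mul_left k4 hQ1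
    have k5 : n * (2 * (48 * (s + 1))) ≤ G.card := by
      have : n * (2 * (48 * (s + 1)) + A.card) = n * (2 * (48 * (s + 1))) + n * A.card := by ring
      omega
    calc 2 * (48 * (s + 1)) * V.card ≤ 2 * (48 * (s + 1)) * (2 * n) := Nat.mul_le_mul_left _ hVcard
      _ = 2 * (n * (2 * (48 * (s + 1)))) := by ring
      _ ≤ 2 * G.card := Nat.mul_le_mul_left _ k5

end GKL

namespace GKL

open Classical in
theorem thmR' {p : ℕ} [Fact p.Prime]
    (A B C : Finset (ZMod p)) (hA : A.Nonempty) (hB : B.Nonempty) (hC : C.Nonempty) (h0 : 0 ∉ A)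
    (n : ℕ) (hn : n = A.card * (B.card * C.card)) (hAn : A.card ^ 2 ≤ n) (hCn : C.card ^ 2 ≤ n)
    (hp : n ≤ p ^ 2) (X : Finset (ZMod p))
    (hX : ∀ a ∈ A, ∀ b ∈ B, ∀ c ∈ C, a * (b + c) ∈ X) :
    n ≤ 40000 * X.card ^ 2 := by
  haveI : CharP (AlgebraicClosure (ZMod p)) p :=
    charP_of_injective_algebraMap (algebraMap (ZMod p) _).injective p
  haveI : Infinite (AlgebraicClosure (ZMod p)) := IsAlgClosed.instInfinite
  obtain ⟨θ, hθ⟩ : ∃ θ : AlgebraicClosure (ZMod p), ∀ x : ZMod p, algebraMap _ _ x ≠ θ := by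
    have := (Set.finite_range (algebraMap (ZMod p) (AlgebraicClosure (ZMod p)))).exists_notMem
    obtain ⟨θ, h⟩ := this
    exact ⟨θ, fun x hx => h ⟨x, hx⟩⟩
  refine (thmR (p := p) hθ A B C hA hB hC h0 n hn hAn hCn hp).trans ?_
  gcongr
  intro u hu
  obtain ⟨x, hx, rfl⟩ := (@mem_image _ _ (_) _ _ _).1 hu
  rw [mem_product, mem_product] at hx
  exact hX _ hx.1 _ hx.2.1 _ hx.2.2

theorem final {p : ℕ} [Fact p.Prime] (h : (ZMod p)ˣ)
    (hg : ∀ u : (ZMod p)ˣ, u ∈ Subgroup.zpowers h) (N : ℕ) (hN : 1 ≤ N) (hNp : N ^ 2 ≤ p)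
    (X : Finset (ZMod p))
    (hX : ∀ x ∈ Icc 1 N, ∀ y ∈ Icc 1 N, ∀ z ∈ Icc 1 N, ∀ t ∈ Icc 1 N, ∀ v ∈ Icc 1 N,
      (h : ZMod p) ^ x * ((h : ZMod p) ^ y + (h : ZMod p) ^ z + (h : ZMod p) ^ t
        + (h : ZMod p) ^ v) ∈ X) :
    N ^ 2 ≤ 360000 * X.card := by
  classical
  have hX1 : 1 ≤ X.card := by
    have h1 : (1 : ℕ) ∈ Icc 1 N := by simp [hN]
    exact Finset.card_pos.2 ⟨_, hX 1 h1 1 h1 1 h1 1 h1 1 h1⟩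
  by_cases hsmall : N < 400
  · have : N ^ 2 ≤ 400 ^ 2 := Nat.pow_le_pow_left hsmall.le 2
    omega
  obtain ⟨M, hM⟩ : ∃ M, M = N / 2 := ⟨_, rfl⟩
  have hM200 : 200 ≤ M := by omega
  have hMN : 2 * M ≤ N := by omega
  have hN3 : N ≤ 3 * M := by omega
  have hord : orderOf h = p - 1 := by
    rw [orderOf_eq_card_of_forall_mem_zpowers hg, Nat.card_eq_fintype_card, ZMod.card_units]
  have hMp : M < p - 1 := by
    have : 400 * N ≤ p := by nlinarith
    omega
  set A : Finset (ZMod p) := (Icc 1 M).image (fun i => (h : ZMod p) ^ i) with hA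
  have hAc : A.card = M := by
    rw [hA, card_image_of_injOn, Nat.card_Icc]
    · omega
    · intro i hi j hj hij
      simp only [coe_Icc, Set.mem_Icc] at hi hj
      apply pow_injOn_Iio_orderOf (x := h)
      · rw [hord]; exact lt_of_le_of_lt hi.2 hMp
      · rw [hord]; exact lt_of_le_of_lt hj.2 hMp
      · apply Units.ext
        simpa using hij
  have hA0 : (0 : ZMod p) ∉ A := by
    intro h0
    obtain ⟨i, -, hi⟩ := mem_image.1 h0
    exact (pow_ne_zero i h.ne_zero) hi
  have hAne : A.Nonempty := card_pos.1 (by omega)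
  set S : Finset (ZMod p) := (Icc 1 N ×ˢ Icc 1 N).image
    (fun q => (h : ZMod p) ^ q.1 + (h : ZMod p) ^ q.2) with hS
  have hMMp : M ^ 2 ≤ p := le_trans (Nat.pow_le_pow_left (by omega) 2) hNp
  have hM4 : M ^ 4 ≤ p ^ 2 := by
    calc M ^ 4 = (M ^ 2) ^ 2 := by ring
      _ ≤ p ^ 2 := Nat.pow_le_pow_left hMMp 2
  have hM0 : 0 < M := by omega
  have h1 : M ^ 3 ≤ 40000 * S.card ^ 2 := by
    refine thmR' A A A hAne hAne hAne hA0 (M ^ 3) (by rw [hAc]; ring) ?_ ?_ ?_ S ?_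
    · rw [hAc]; exact Nat.pow_le_pow_right hM0 (by norm_num)
    · rw [hAc]; exact Nat.pow_le_pow_right hM0 (by norm_num)
    · exact (Nat.pow_le_pow_right hM0 (by norm_num)).trans hM4
    · intro a ha b hb c hc
      obtain ⟨i, hi, rfl⟩ := mem_image.1 ha
      obtain ⟨j, hj, rfl⟩ := mem_image.1 hb
      obtain ⟨k, hk, rfl⟩ := mem_image.1 hc
      rw [mem_Icc] at hi hj hk
      refine mem_image.2 ⟨(i + j, i + k), ?_, ?_⟩
      · rw [mem_product, mem_Icc, mem_Icc]
        simp only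
        omega
      · simp only [pow_add]
        ring
  obtain ⟨r, hr⟩ : ∃ r, r = Nat.sqrt (M ^ 3) := ⟨_, rfl⟩
  have hr1 : r * r ≤ M ^ 3 := hr ▸ Nat.sqrt_le _
  have hr2 : M ^ 3 < (r + 1) * (r + 1) := hr ▸ Nat.lt_succ_sqrt _
  have hM3 : 40000 * M ≤ M ^ 3 := by
    calc 40000 * M = (200 * 200) * M := by norm_num
      _ ≤ (M * M) * M := Nat.mul_le_mul_right _ (Nat.mul_le_mul hM200 hM200)
      _ = M ^ 3 := by ring
  have hr0 : 1 ≤ r := by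
    by_contra hh
    have : r = 0 := by omega
    rw [this] at hr2
    omega
  obtain ⟨B, hBS, hBc⟩ := Finset.exists_subset_card_eq (s := S) (min_le_left S.card r)
  have hb1 : B.card ^ 2 ≤ M ^ 3 := by
    rw [hBc]
    exact (Nat.pow_le_pow_left (min_le_right _ _) 2).trans (by rw [sq]; exact hr1)
  have hb2 : M ^ 3 ≤ 40000 * B.card ^ 2 := by
    rcases min_choice S.card r with hh | hh
    · rw [hBc, hh]; exact h1
    · rw [hBc, hh]; nlinarith
  have hMb : M ≤ B.card ^ 2 := by omega
  have hBne : B.Nonempty := by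
    rw [← card_pos]
    by_contra hh
    have : B.card = 0 := by omega
    rw [this] at hMb
    omega
  have h2 : M * B.card ^ 2 ≤ 40000 * X.card ^ 2 := by
    refine thmR' A B B hAne hBne hBne hA0 (M * B.card ^ 2) (by rw [hAc]; ring) ?_ ?_ ?_ X ?_
    · rw [hAc, sq]; exact Nat.mul_le_mul_left _ hMb
    · exact Nat.le_mul_of_pos_left _ hM0
    · calc M * B.card ^ 2 ≤ M * M ^ 3 := Nat.mul_le_mul_left _ hb1
        _ = M ^ 4 := by ring
        _ ≤ p ^ 2 := hM4
    · intro a ha b hb c hc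
      obtain ⟨i, hi, rfl⟩ := mem_image.1 ha
      obtain ⟨⟨y, z⟩, hj, rfl⟩ := mem_image.1 (hBS hb)
      obtain ⟨⟨t, v⟩, hk, rfl⟩ := mem_image.1 (hBS hc)
      rw [mem_product] at hj hk
      have hi' : i ∈ Icc 1 N := by
        rw [mem_Icc] at hi ⊢
        omega
      have := hX i hi' y hj.1 z hj.2 t hk.1 v hk.2
      simp only
      rw [← add_assoc]
      exact this
  have h3 : (M ^ 2) ^ 2 ≤ (40000 * X.card) ^ 2 := by
    calc (M ^ 2) ^ 2 = M * M ^ 3 := by ring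
      _ ≤ M * (40000 * B.card ^ 2) := Nat.mul_le_mul_left _ hb2
      _ = 40000 * (M * B.card ^ 2) := by ring
      _ ≤ 40000 * (40000 * X.card ^ 2) := Nat.mul_le_mul_left _ h2
      _ = (40000 * X.card) ^ 2 := by ring
  have h4 : M ^ 2 ≤ 40000 * X.card := (Nat.pow_le_pow_iff_left two_ne_zero).1 h3
  calc N ^ 2 ≤ (3 * M) ^ 2 := Nat.pow_le_pow_left hN3 2
    _ = 9 * M ^ 2 := by ring
    _ ≤ 360000 * X.card := by omega

end GKL
theorem stmt_3 :
    ∃ c : ℝ, 0 < c ∧ ∀ (p : ℕ), p.Prime → 2 < p →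
      ∀ h : (ZMod p)ˣ, (∀ u : (ZMod p)ˣ, u ∈ Subgroup.zpowers h) →
      ∀ N : ℕ, 1 ≤ N → (N : ℝ) ≤ (p : ℝ) ^ ((1 : ℝ) / 2) →
      c * (N : ℝ) ^ 2 ≤
        ((((Finset.Icc 1 N ×ˢ ((Finset.Icc 1 N ×ˢ Finset.Icc 1 N) ×ˢ
            (Finset.Icc 1 N ×ˢ Finset.Icc 1 N)))).image
          (fun q => (h : ZMod p) ^ q.1 *
            ((h : ZMod p) ^ q.2.1.1 + (h : ZMod p) ^ q.2.1.2 +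
             (h : ZMod p) ^ q.2.2.1 + (h : ZMod p) ^ q.2.2.2))).card : ℝ) := by
  refine ⟨1 / 360000, by norm_num, ?_⟩
  intro p hp _ h hg N hN hNp
  haveI : Fact p.Prime := ⟨hp⟩
  have hNp' : N ^ 2 ≤ p := by
    rw [← Real.sqrt_eq_rpow, Real.le_sqrt (by positivity) (by positivity)] at hNp
    exact_mod_cast hNp
  generalize hX : @Finset.image _ _ (_) _ _ = X
  have key := GKL.final h hg N hN hNp' X (by
    intro x hx y hy z hz t ht v hv
    rw [← hX]
    refine Finset.mem_image.2 ⟨(x, (y, z), (t, v)), ?_, rfl⟩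
    simp only [Finset.mem_product]
    exact ⟨hx, ⟨hy, hz⟩, ht, hv⟩)
  have key' := (Nat.cast_le (α := ℝ)).2 key
  push_cast at key'
  linarith
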